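/- Let A be a compact (finite-dimensional total cohomology) and homologically smooth DG algebra over a field k. Then the total Hochschild homology ⊕_n HH_n(A) is finite-dimensional over k. -/

import Mathlib

/- Framework: differential graded algebras (internal ℤ-grading), right DG modules,
DG bimodules, homotopy-theoretic notions (twisted modules, perfectness,
homological smoothness), cohomology and Hochschild homology. -/

open DirectSum TensorProduct

noncomputable section
set_option linter.unusedVariables false

/-- `(-1)^i` for `i : ℤ`, valued in `ℤ`. -/
def sgnz (i : ℤ) : ℤ := if Even i then 1 else -1

/-- `(-1)^i` for `i : ℤ`, valued in a field `k`. -/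
def sgnk (k : Type) [Field k] (i : ℤ) : k := if Even i then 1 else -1

/-- A differential graded algebra over a field `k`: a `k`-algebra with an internal
ℤ-grading and a square-zero degree `+1` differential satisfying the graded Leibniz rule. -/
structure DGAlgebra (k : Type) [Field k] : Type 1 where
  R : Type
  [ring : Ring R]
  [alg : Algebra k R]
  gr : ℤ → Submodule k R
  [dec : DirectSum.Decomposition gr]
  one_mem : (1 : R) ∈ gr 0
  mul_mem : ∀ {i j : ℤ} {x y : R}, x ∈ gr i → y ∈ gr j → x * y ∈ gr (i + j)
  d : R →ₗ[k] R
  d_deg : ∀ (i : ℤ), ∀ x ∈ gr i, d x ∈ gr (i + 1)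
  d_sq : ∀ x : R, d (d x) = 0
  leibniz : ∀ (i : ℤ), ∀ x ∈ gr i, ∀ y : R,
    d (x * y) = d x * y + sgnz i • (x * d y)

attribute [instance] DGAlgebra.ring DGAlgebra.alg DGAlgebra.dec

variable {k : Type} [Field k]

/-- A right DG module over a DG algebra `A`.  The right action of `x : A` on `m`
is written `act x m` (representing `m · x`). -/
structure DGMod (A : DGAlgebra k) : Type 1 where
  M : Type
  [acg : AddCommGroup M]
  [kmod : Module k M]
  gm : ℤ → Submodule k M
  [dec : DirectSum.Decomposition gm]
  act : A.R →ₗ[k] M →ₗ[k] M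
  act_one : ∀ m : M, act 1 m = m
  act_mul : ∀ (x y : A.R) (m : M), act (x * y) m = act y (act x m)
  act_deg : ∀ (i j : ℤ) (x : A.R) (m : M), x ∈ A.gr i → m ∈ gm j → act x m ∈ gm (j + i)
  D : M →ₗ[k] M
  D_deg : ∀ (j : ℤ), ∀ m ∈ gm j, D m ∈ gm (j + 1)
  D_sq : ∀ m : M, D (D m) = 0
  leibniz : ∀ (i j : ℤ) (x : A.R) (m : M), x ∈ A.gr i → m ∈ gm j →
    D (act x m) = act x (D m) + sgnz j • act (A.d x) m

attribute [instance] DGMod.acg DGMod.kmod DGMod.dec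

variable {A : DGAlgebra k}

/-- Morphisms of right DG modules (closed, degree 0). -/
structure DGHom (X Y : DGMod A) where
  f : X.M →ₗ[k] Y.M
  deg : ∀ (j : ℤ), ∀ m ∈ X.gm j, f m ∈ Y.gm j
  actc : ∀ (x : A.R) (m : X.M), f (X.act x m) = Y.act x (f m)
  comm : ∀ m : X.M, f (X.D m) = Y.D (f m)

/-- The identity morphism. -/
def DGHom.id (X : DGMod A) : DGHom X X :=
  ⟨LinearMap.id, fun _ _ h => h, fun _ _ => rfl, fun _ => rfl⟩

/-- Composition of morphisms of DG modules. -/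
def DGHom.comp {X Y Z : DGMod A} (G : DGHom Y Z) (F : DGHom X Y) : DGHom X Z :=
  ⟨G.f ∘ₗ F.f, fun j m h => G.deg j _ (F.deg j m h),
    fun x m => by simp [LinearMap.comp_apply, F.actc, G.actc],
    fun m => by simp [LinearMap.comp_apply, F.comm, G.comm]⟩

/-- The zero morphism. -/
def DGHom.zero (X Y : DGMod A) : DGHom X Y :=
  ⟨0, fun j _ _ => (Y.gm j).zero_mem, fun _ _ => by simp, fun _ => by simp⟩

/-- Chain homotopy between two morphisms of DG modules. -/
def Homotopic {X Y : DGMod A} (F G : DGHom X Y) : Prop :=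
  ∃ h : X.M →ₗ[k] Y.M,
    (∀ (j : ℤ), ∀ m ∈ X.gm j, h m ∈ Y.gm (j - 1)) ∧
    (∀ (x : A.R) (m : X.M), h (X.act x m) = Y.act x (h m)) ∧
    ∀ m : X.M, F.f m - G.f m = Y.D (h m) + h (X.D m)

/-- Cycles of degree `n` of a complex given by a grading and a differential. -/
def Zg {M : Type} [AddCommGroup M] [Module k M]
    (gm : ℤ → Submodule k M) (Dm : M →ₗ[k] M) (n : ℤ) : Submodule k M :=
  gm n ⊓ LinearMap.ker Dm

/-- Boundaries of degree `n`. -/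
def Bg {M : Type} [AddCommGroup M] [Module k M]
    (gm : ℤ → Submodule k M) (Dm : M →ₗ[k] M) (n : ℤ) : Submodule k M :=
  gm n ⊓ LinearMap.range Dm

/-- Degree `n` cohomology of a complex. -/
def Hg {M : Type} [AddCommGroup M] [Module k M]
    (gm : ℤ → Submodule k M) (Dm : M →ₗ[k] M) (n : ℤ) : Type :=
  ↥(Zg gm Dm n) ⧸ (Submodule.comap (Zg gm Dm n).subtype (Bg gm Dm n))

instance {M : Type} [AddCommGroup M] [Module k M]
    (gm : ℤ → Submodule k M) (Dm : M →ₗ[k] M) (n : ℤ) : AddCommGroup (Hg gm Dm n) := by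
  unfold Hg; infer_instance

instance {M : Type} [AddCommGroup M] [Module k M]
    (gm : ℤ → Submodule k M) (Dm : M →ₗ[k] M) (n : ℤ) : Module k (Hg gm Dm n) := by
  unfold Hg; infer_instance

/-- `f` induces an isomorphism on the homology of two complexes presented by
(families of) cycle and boundary submodules. -/
def InducesHIso {M₁ M₂ : Type} [AddCommGroup M₁] [Module k M₁] [AddCommGroup M₂] [Module k M₂]
    (Z₁ B₁ : ℤ → Submodule k M₁) (Z₂ B₂ : ℤ → Submodule k M₂) (f : M₁ →ₗ[k] M₂) : Prop :=
  (∀ n : ℤ, ∀ x ∈ Z₁ n, f x ∈ Z₂ n) ∧ (∀ n : ℤ, ∀ x ∈ B₁ n, f x ∈ B₂ n) ∧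
  ∀ n : ℤ, (∀ z ∈ Z₂ n, ∃ w ∈ Z₁ n, f w - z ∈ B₂ n) ∧
    (∀ w ∈ Z₁ n, f w ∈ B₂ n → w ∈ B₁ n)

/-- Quasi-isomorphism of complexes, in elementary terms. -/
def QIsoData {M₁ M₂ : Type} [AddCommGroup M₁] [Module k M₁] [AddCommGroup M₂] [Module k M₂]
    (gm₁ : ℤ → Submodule k M₁) (D₁ : M₁ →ₗ[k] M₁)
    (gm₂ : ℤ → Submodule k M₂) (D₂ : M₂ →ₗ[k] M₂) (f : M₁ →ₗ[k] M₂) : Prop :=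
  InducesHIso (Zg gm₁ D₁) (Bg gm₁ D₁) (Zg gm₂ D₂) (Bg gm₂ D₂) f

/-- A morphism of DG modules is a quasi-isomorphism if it induces isomorphisms on
all cohomology groups. -/
def IsQuasiIso {X Y : DGMod A} (F : DGHom X Y) : Prop :=
  QIsoData X.gm X.D Y.gm Y.D F.f

/-- A DG module is acyclic if all its cohomology vanishes. -/
def AcyclicM (X : DGMod A) : Prop := ∀ n : ℤ, Zg X.gm X.D n ≤ Bg X.gm X.D n

/-- The `A`-submodule of a right DG module generated by a set. -/
def rSpan (X : DGMod A) (S : Set X.M) : Submodule k X.M :=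
  sInf {p : Submodule k X.M | S ⊆ ↑p ∧ ∀ (x : A.R) (m : X.M), m ∈ p → X.act x m ∈ p}

/-- Twisted modules: finitely generated semi-free right DG `A`-modules, i.e.
modules with a finite homogeneous basis `e` such that `D (e j)` lies in the
`A`-span of the previous basis elements ("strictly upper triangular" twisting). -/
def IsTwisted (T : DGMod A) : Prop :=
  ∃ (s : ℕ) (r : Fin s → ℤ) (e : Fin s → T.M),
    (∀ j, e j ∈ T.gm (-(r j))) ∧
    (∀ j, T.D (e j) ∈ rSpan T (e '' {i | i < j})) ∧
    Function.Bijective (fun v : Fin s → A.R => ∑ j, T.act (v j) (e j))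

/-- `P` is a homotopy direct summand of `T`. -/
def IsHoSummand (P T : DGMod A) : Prop :=
  ∃ (ι : DGHom P T) (ρ : DGHom T P), Homotopic (ρ.comp ι) (DGHom.id P)

/-- A perfect DG module: one admitting a resolution by a homotopy direct summand
of a twisted module. -/
def IsPerfect (N : DGMod A) : Prop :=
  ∃ T P : DGMod A, IsTwisted T ∧ IsHoSummand P T ∧ ∃ F : DGHom P N, IsQuasiIso F

/-- Homotopically projective (K-projective) DG modules. -/
def IsHoProjM (P : DGMod A) : Prop :=
  ∀ N : DGMod A, AcyclicM N → ∀ F : DGHom P N, Homotopic F (DGHom.zero P N)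

/-- Compactness of a DG algebra: the total cohomology is finite dimensional. -/
def IsCompactAlg (A : DGAlgebra k) : Prop :=
  (∀ n : ℤ, FiniteDimensional k (Hg A.gr A.d n)) ∧
    {n : ℤ | ¬ Subsingleton (Hg A.gr A.d n)}.Finite
/-- The grading operator on a graded module scaling the degree `j` component by `c j`. -/
def gop {M : Type} [AddCommGroup M] [Module k M]
    (gm : ℤ → Submodule k M) [DirectSum.Decomposition gm] (c : ℤ → k) : M →ₗ[k] M :=
  (DirectSum.toModule k ℤ M (fun j => c j • (gm j).subtype)) ∘ₗ
    (DirectSum.decomposeLinearEquiv gm).toLinearMap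

/-- A DG bimodule over `A` (equivalently, a right DG module over `Aᵉ = Aᵒᵖ ⊗ A`). -/
structure DGBimod (A : DGAlgebra k) : Type 1 where
  M : Type
  [acg : AddCommGroup M]
  [kmod : Module k M]
  gm : ℤ → Submodule k M
  [dec : DirectSum.Decomposition gm]
  actL : A.R →ₗ[k] M →ₗ[k] M
  actR : A.R →ₗ[k] M →ₗ[k] M
  actL_one : ∀ m : M, actL 1 m = m
  actR_one : ∀ m : M, actR 1 m = m
  actL_mul : ∀ (x y : A.R) (m : M), actL (x * y) m = actL x (actL y m)
  actR_mul : ∀ (x y : A.R) (m : M), actR (x * y) m = actR y (actR x m)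
  actLR : ∀ (x y : A.R) (m : M), actL x (actR y m) = actR y (actL x m)
  actL_deg : ∀ (i j : ℤ) (x : A.R) (m : M), x ∈ A.gr i → m ∈ gm j → actL x m ∈ gm (i + j)
  actR_deg : ∀ (i j : ℤ) (x : A.R) (m : M), x ∈ A.gr i → m ∈ gm j → actR x m ∈ gm (j + i)
  D : M →ₗ[k] M
  D_deg : ∀ (j : ℤ), ∀ m ∈ gm j, D m ∈ gm (j + 1)
  D_sq : ∀ m : M, D (D m) = 0
  leibnizL : ∀ (i j : ℤ) (x : A.R) (m : M), x ∈ A.gr i → m ∈ gm j →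
    D (actL x m) = actL (A.d x) m + sgnz i • actL x (D m)
  leibnizR : ∀ (i j : ℤ) (x : A.R) (m : M), x ∈ A.gr i → m ∈ gm j →
    D (actR x m) = actR x (D m) + sgnz j • actR (A.d x) m

attribute [instance] DGBimod.acg DGBimod.kmod DGBimod.dec

/-- Morphisms of DG bimodules (closed, degree 0). -/
structure BimodHom {A : DGAlgebra k} (X Y : DGBimod A) where
  f : X.M →ₗ[k] Y.M
  deg : ∀ (j : ℤ), ∀ m ∈ X.gm j, f m ∈ Y.gm j
  actLc : ∀ (x : A.R) (m : X.M), f (X.actL x m) = Y.actL x (f m)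
  actRc : ∀ (x : A.R) (m : X.M), f (X.actR x m) = Y.actR x (f m)
  comm : ∀ m : X.M, f (X.D m) = Y.D (f m)

def BimodHom.id (X : DGBimod A) : BimodHom X X :=
  ⟨LinearMap.id, fun _ _ h => h, fun _ _ => rfl, fun _ _ => rfl, fun _ => rfl⟩

def BimodHom.comp {X Y Z : DGBimod A} (G : BimodHom Y Z) (F : BimodHom X Y) : BimodHom X Z :=
  ⟨G.f ∘ₗ F.f, fun j m h => G.deg j _ (F.deg j m h),
    fun x m => by simp [LinearMap.comp_apply, F.actLc, G.actLc],
    fun x m => by simp [LinearMap.comp_apply, F.actRc, G.actRc],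
    fun m => by simp [LinearMap.comp_apply, F.comm, G.comm]⟩

def BimodHom.zero (X Y : DGBimod A) : BimodHom X Y :=
  ⟨0, fun j _ _ => (Y.gm j).zero_mem, fun _ _ => by simp, fun _ _ => by simp, fun _ => by simp⟩

/-- Chain homotopy between morphisms of DG bimodules (with the Koszul sign for the
left action). -/
def BimodHomotopic {X Y : DGBimod A} (F G : BimodHom X Y) : Prop :=
  ∃ h : X.M →ₗ[k] Y.M,
    (∀ (j : ℤ), ∀ m ∈ X.gm j, h m ∈ Y.gm (j - 1)) ∧
    (∀ (i : ℤ) (x : A.R), x ∈ A.gr i → ∀ m : X.M, h (X.actL x m) = sgnz i • Y.actL x (h m)) ∧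
    (∀ (x : A.R) (m : X.M), h (X.actR x m) = Y.actR x (h m)) ∧
    ∀ m : X.M, F.f m - G.f m = Y.D (h m) + h (X.D m)

def AcyclicB (X : DGBimod A) : Prop := ∀ n : ℤ, Zg X.gm X.D n ≤ Bg X.gm X.D n

def IsHoProjB (P : DGBimod A) : Prop :=
  ∀ N : DGBimod A, AcyclicB N → ∀ F : BimodHom P N, BimodHomotopic F (BimodHom.zero P N)

/-- Auxiliary: the action of a homogeneous element of degree `i` in the first tensor
factor of `Aᵉ` on a bimodule, with its Koszul sign. -/
def biactAux (N : DGBimod A) (i : ℤ) : ↥(A.gr i) →ₗ[k] A.R →ₗ[k] N.M →ₗ[k] N.M where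
  toFun x :=
    { toFun := fun y => (N.actL ↑x) ∘ₗ (N.actR y) ∘ₗ (gop N.gm fun j => sgnk k (i * j))
      map_add' := by intro y z; ext m; simp
      map_smul' := by intro c y; ext m; simp }
  map_add' := by intro x z; ext y m; simp [Submodule.coe_add]
  map_smul' := by intro c x; ext y m; simp

/-- The right action of `Aᵉ = Aᵒᵖ ⊗ A` (as a `k`-module, `A.R ⊗[k] A.R`) on a DG
bimodule, with Koszul signs. -/
def biact (N : DGBimod A) : (A.R ⊗[k] A.R) →ₗ[k] N.M →ₗ[k] N.M :=
  TensorProduct.lift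
    ((DirectSum.toModule k ℤ _ (fun i => biactAux N i)) ∘ₗ
      (DirectSum.decomposeLinearEquiv A.gr).toLinearMap)

/-- The sub-bimodule generated by a set. -/
def biSpan (N : DGBimod A) (S : Set N.M) : Submodule k N.M :=
  sInf {p : Submodule k N.M | S ⊆ ↑p ∧ (∀ (x : A.R) (m : N.M), m ∈ p → N.actL x m ∈ p) ∧
    ∀ (x : A.R) (m : N.M), m ∈ p → N.actR x m ∈ p}

/-- Twisted DG bimodules: finitely generated semi-free DG `Aᵉ`-modules. -/
def IsTwistedB (T : DGBimod A) : Prop :=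
  ∃ (s : ℕ) (r : Fin s → ℤ) (e : Fin s → T.M),
    (∀ j, e j ∈ T.gm (-(r j))) ∧
    (∀ j, T.D (e j) ∈ biSpan T (e '' {i | i < j})) ∧
    Function.Bijective (fun v : Fin s → A.R ⊗[k] A.R => ∑ j, biact T (v j) (e j))

def IsHoSummandB (P T : DGBimod A) : Prop :=
  ∃ (ι : BimodHom P T) (ρ : BimodHom T P), BimodHomotopic (ρ.comp ι) (BimodHom.id P)

def IsPerfectB (N : DGBimod A) : Prop :=
  ∃ T P : DGBimod A, IsTwistedB T ∧ IsHoSummandB P T ∧ ∃ F : BimodHom P N, QIsoData P.gm P.D N.gm N.D F.f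

/-- The diagonal bimodule: `A` as a DG bimodule over itself. -/
def diagBimod (A : DGAlgebra k) : DGBimod A where
  M := A.R
  gm := A.gr
  actL := LinearMap.mul k A.R
  actR := (LinearMap.mul k A.R).flip
  actL_one := fun m => one_mul m
  actR_one := fun m => mul_one m
  actL_mul := fun x y m => mul_assoc x y m
  actR_mul := fun x y m => (mul_assoc m x y).symm
  actLR := fun x y m => (mul_assoc x m y).symm
  actL_deg := fun i j x m hx hm => A.mul_mem hx hm
  actR_deg := fun i j x m hx hm => A.mul_mem hm hx
  D := A.d
  D_deg := A.d_deg
  D_sq := A.d_sq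
  leibnizL := fun i j x m hx _ => A.leibniz i x hx m
  leibnizR := fun i j x m _ hm => A.leibniz j m hm x

/-- `A` is homologically smooth if the diagonal bimodule is perfect over `Aᵉ`. -/
def IsSmooth (A : DGAlgebra k) : Prop := IsPerfectB (diagBimod A)

/-- The graded commutator subspace `[A, P] ⊆ P` of a DG bimodule. -/
def commSub (P : DGBimod A) : Submodule k P.M :=
  Submodule.span k {z : P.M | ∃ (i j : ℤ) (x : A.R) (m : P.M), x ∈ A.gr i ∧ m ∈ P.gm j ∧
    z = P.actL x m - sgnz (i * j) • P.actR x m}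

/-- Degree-`n` cycles of the complex `P/[A,P]` (computing `P ⊗_{Aᵉ} A`), described by
representatives in `P`. -/
def HHZ (P : DGBimod A) (n : ℤ) : Submodule k P.M :=
  P.gm n ⊓ (commSub P).comap P.D

/-- Degree-`n` boundaries of the complex `P/[A,P]`, described by representatives. -/
def HHB (P : DGBimod A) (n : ℤ) : Submodule k P.M :=
  P.gm n ⊓ (commSub P ⊔ LinearMap.range P.D)

/-- The `n`-th Hochschild homology group `HH_n(A) = H^n(P ⊗_{Aᵉ} A)` computed from a
bimodule resolution `P` of the diagonal. -/
def HHspace (P : DGBimod A) (n : ℤ) : Type :=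
  ↥(HHZ P n) ⧸ (Submodule.comap (HHZ P n).subtype (HHB P n ⊓ HHZ P n))

instance (P : DGBimod A) (n : ℤ) : AddCommGroup (HHspace P n) := by
  unfold HHspace; infer_instance

instance (P : DGBimod A) (n : ℤ) : Module k (HHspace P n) := by
  unfold HHspace; infer_instance

/-- `F : P → A` is an h-projective bimodule resolution of the diagonal bimodule. -/
def IsDiagResolution {A : DGAlgebra k} (P : DGBimod A) (F : BimodHom P (diagBimod A)) : Prop :=
  IsHoProjB P ∧ QIsoData P.gm P.D (diagBimod A).gm (diagBimod A).D F.f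
/-! ### Hom complexes and Ext spaces -/

/-- The degree-`n` part of the Hom complex of two right DG `A`-modules:
`A`-linear maps shifting degrees by `n`. -/
def homGrade (X Y : DGMod A) (n : ℤ) : Submodule k (X.M →ₗ[k] Y.M) where
  carrier := {f | (∀ (j : ℤ), ∀ m ∈ X.gm j, f m ∈ Y.gm (j + n)) ∧
    ∀ (x : A.R) (m : X.M), f (X.act x m) = Y.act x (f m)}
  add_mem' := by
    rintro f g ⟨hf1, hf2⟩ ⟨hg1, hg2⟩
    refine ⟨fun j m hm => ?_, fun x m => ?_⟩
    · exact (Y.gm (j + n)).add_mem (hf1 j m hm) (hg1 j m hm)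
    · simp [hf2, hg2]
  zero_mem' := by
    refine ⟨fun j m hm => (Y.gm (j + n)).zero_mem, fun x m => by simp⟩
  smul_mem' := by
    rintro c f ⟨hf1, hf2⟩
    refine ⟨fun j m hm => (Y.gm (j + n)).smul_mem c (hf1 j m hm), fun x m => ?_⟩
    simp [hf2]

theorem mem_homGrade {X Y : DGMod A} {n : ℤ} {f : X.M →ₗ[k] Y.M} :
    f ∈ homGrade X Y n ↔ ((∀ (j : ℤ), ∀ m ∈ X.gm j, f m ∈ Y.gm (j + n)) ∧
      ∀ (x : A.R) (m : X.M), f (X.act x m) = Y.act x (f m)) := Iff.rfl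

/-- The differential of the Hom complex in degree `n`:
`f ↦ D_Y ∘ f - (-1)^n f ∘ D_X`. -/
def homDop (X Y : DGMod A) (n : ℤ) : (X.M →ₗ[k] Y.M) →ₗ[k] (X.M →ₗ[k] Y.M) :=
  (LinearMap.llcomp k X.M Y.M Y.M) Y.D - sgnz n • (LinearMap.llcomp k X.M X.M Y.M).flip X.D

/-- Closed degree-`n` `A`-linear maps. -/
def ZHomS (X Y : DGMod A) (n : ℤ) : Submodule k (X.M →ₗ[k] Y.M) :=
  homGrade X Y n ⊓ LinearMap.ker (homDop X Y n)

/-- Degree-`n` boundaries of the Hom complex. -/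
def BHomS (X Y : DGMod A) (n : ℤ) : Submodule k (X.M →ₗ[k] Y.M) :=
  Submodule.map (homDop X Y (n - 1)) (homGrade X Y (n - 1))

/-- `Hom_{Ho(A)}(X, Y[n])`: the `n`-th cohomology of the Hom complex.  For
homotopically projective `X` this computes `Hom_{D(A)}(X, Y[n])`. -/
def ExtSpace (X Y : DGMod A) (n : ℤ) : Type :=
  ↥(ZHomS X Y n) ⧸ (Submodule.comap (ZHomS X Y n).subtype (BHomS X Y n ⊓ ZHomS X Y n))

instance (X Y : DGMod A) (n : ℤ) : AddCommGroup (ExtSpace X Y n) := by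
  unfold ExtSpace; infer_instance

instance (X Y : DGMod A) (n : ℤ) : Module k (ExtSpace X Y n) := by
  unfold ExtSpace; infer_instance

/-! ### Shifts, cones, isomorphisms in the homotopy category -/

/-- `X'` realizes the shift `X[t]` (so `X'^n = X^{n+t}`). -/
def IsShiftOf (X X' : DGMod A) (t : ℤ) : Prop :=
  ∃ g : X.M ≃ₗ[k] X'.M,
    (∀ n : ℤ, ∀ m ∈ X.gm (n + t), g m ∈ X'.gm n) ∧
    (∀ (x : A.R) (m : X.M), g (X.act x m) = X'.act x (g m)) ∧
    ∀ m : X.M, g (X.D m) = sgnz t • X'.D (g m)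

/-- `C` realizes the cone of the closed morphism `F : X → Y` with canonical
inclusion `j : Y → C`. -/
def IsConeOf {X Y : DGMod A} (F : DGHom X Y) (C : DGMod A) (j : DGHom Y C) : Prop :=
  ∃ (p : C.M →ₗ[k] X.M) (s : X.M →ₗ[k] C.M) (q : C.M →ₗ[k] Y.M),
    (∀ n : ℤ, ∀ c ∈ C.gm n, p c ∈ X.gm (n + 1)) ∧
    (∀ n : ℤ, ∀ m ∈ X.gm (n + 1), s m ∈ C.gm n) ∧
    (∀ n : ℤ, ∀ c ∈ C.gm n, q c ∈ Y.gm n) ∧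
    (∀ (x : A.R) (c : C.M), p (C.act x c) = X.act x (p c)) ∧
    (∀ (x : A.R) (m : X.M), s (X.act x m) = C.act x (s m)) ∧
    (∀ (x : A.R) (c : C.M), q (C.act x c) = Y.act x (q c)) ∧
    (∀ y : Y.M, q (j.f y) = y) ∧ (∀ m : X.M, p (s m) = m) ∧
    (∀ m : X.M, q (s m) = 0) ∧ (∀ y : Y.M, p (j.f y) = 0) ∧
    (∀ c : C.M, j.f (q c) + s (p c) = c) ∧
    ∀ m : X.M, C.D (s m) = j.f (F.f m) - s (X.D m)

/-- Isomorphism in the homotopy category of DG modules. -/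
def HoIso (X Y : DGMod A) : Prop :=
  ∃ (F : DGHom X Y) (G : DGHom Y X),
    Homotopic (G.comp F) (DGHom.id X) ∧ Homotopic (F.comp G) (DGHom.id Y)
/-! ### Left DG modules (right modules over `Aᵒᵖ`) and duality complexes -/

/-- A left DG module over `A` (equivalently, a right DG module over `Aᵒᵖ`). -/
structure DGModL (A : DGAlgebra k) : Type 1 where
  M : Type
  [acg : AddCommGroup M]
  [kmod : Module k M]
  gm : ℤ → Submodule k M
  [dec : DirectSum.Decomposition gm]
  actL : A.R →ₗ[k] M →ₗ[k] M
  actL_one : ∀ m : M, actL 1 m = m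
  actL_mul : ∀ (x y : A.R) (m : M), actL (x * y) m = actL x (actL y m)
  actL_deg : ∀ (i j : ℤ) (x : A.R) (m : M), x ∈ A.gr i → m ∈ gm j → actL x m ∈ gm (i + j)
  D : M →ₗ[k] M
  D_deg : ∀ (j : ℤ), ∀ m ∈ gm j, D m ∈ gm (j + 1)
  D_sq : ∀ m : M, D (D m) = 0
  leibnizL : ∀ (i j : ℤ) (x : A.R) (m : M), x ∈ A.gr i → m ∈ gm j →
    D (actL x m) = actL (A.d x) m + sgnz i • actL x (D m)

attribute [instance] DGModL.acg DGModL.kmod DGModL.dec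

/-- Morphisms of left DG modules. -/
structure DGHomL (X Y : DGModL A) where
  f : X.M →ₗ[k] Y.M
  deg : ∀ (j : ℤ), ∀ m ∈ X.gm j, f m ∈ Y.gm j
  actc : ∀ (x : A.R) (m : X.M), f (X.actL x m) = Y.actL x (f m)
  comm : ∀ m : X.M, f (X.D m) = Y.D (f m)

def DGHomL.id (X : DGModL A) : DGHomL X X :=
  ⟨LinearMap.id, fun _ _ h => h, fun _ _ => rfl, fun _ => rfl⟩

def DGHomL.comp {X Y Z : DGModL A} (G : DGHomL Y Z) (F : DGHomL X Y) : DGHomL X Z :=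
  ⟨G.f ∘ₗ F.f, fun j m h => G.deg j _ (F.deg j m h),
    fun x m => by simp [LinearMap.comp_apply, F.actc, G.actc],
    fun m => by simp [LinearMap.comp_apply, F.comm, G.comm]⟩

def HomotopicL {X Y : DGModL A} (F G : DGHomL X Y) : Prop :=
  ∃ h : X.M →ₗ[k] Y.M,
    (∀ (j : ℤ), ∀ m ∈ X.gm j, h m ∈ Y.gm (j - 1)) ∧
    (∀ (i : ℤ) (x : A.R), x ∈ A.gr i → ∀ m : X.M, h (X.actL x m) = sgnz i • Y.actL x (h m)) ∧
    ∀ m : X.M, F.f m - G.f m = Y.D (h m) + h (X.D m)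

def lSpan (X : DGModL A) (S : Set X.M) : Submodule k X.M :=
  sInf {p : Submodule k X.M | S ⊆ ↑p ∧ ∀ (x : A.R) (m : X.M), m ∈ p → X.actL x m ∈ p}

def IsTwistedL (T : DGModL A) : Prop :=
  ∃ (s : ℕ) (r : Fin s → ℤ) (e : Fin s → T.M),
    (∀ j, e j ∈ T.gm (-(r j))) ∧
    (∀ j, T.D (e j) ∈ lSpan T (e '' {i | i < j})) ∧
    Function.Bijective (fun v : Fin s → A.R => ∑ j, T.actL (v j) (e j))

def IsHoSummandL (P T : DGModL A) : Prop :=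
  ∃ (ι : DGHomL P T) (ρ : DGHomL T P), HomotopicL (ρ.comp ι) (DGHomL.id P)

def IsPerfectL (N : DGModL A) : Prop :=
  ∃ T P : DGModL A, IsTwistedL T ∧ IsHoSummandL P T ∧
    ∃ F : DGHomL P N, QIsoData P.gm P.D N.gm N.D F.f

/-- The degree-`n` part of the complex `Hom_A(X, A)` of right `A`-module maps into `A`. -/
def rHomGrade (X : DGMod A) (n : ℤ) : Submodule k (X.M →ₗ[k] A.R) where
  carrier := {g | (∀ (j : ℤ), ∀ m ∈ X.gm j, g m ∈ A.gr (j + n)) ∧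
    ∀ (x : A.R) (m : X.M), g (X.act x m) = g m * x}
  add_mem' := by
    rintro f g ⟨hf1, hf2⟩ ⟨hg1, hg2⟩
    exact ⟨fun j m hm => (A.gr (j + n)).add_mem (hf1 j m hm) (hg1 j m hm),
      fun x m => by simp [hf2, hg2, add_mul]⟩
  zero_mem' := ⟨fun j m hm => (A.gr (j + n)).zero_mem, fun x m => by simp⟩
  smul_mem' := by
    rintro c f ⟨hf1, hf2⟩
    exact ⟨fun j m hm => (A.gr (j + n)).smul_mem c (hf1 j m hm),
      fun x m => by simp [hf2, Algebra.smul_mul_assoc]⟩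

/-- `V` realizes the dual complex `X^∨ = RHom_A(X, A)` of a (homotopically projective)
right DG module `X`, as a left DG module. -/
def IsRightDualOf (X : DGMod A) (V : DGModL A) : Prop :=
  ∃ Φ : V.M →ₗ[k] (X.M →ₗ[k] A.R),
    Function.Injective Φ ∧
    (∀ n : ℤ, Submodule.map Φ (V.gm n) = rHomGrade X n) ∧
    (∀ (n : ℤ), ∀ v ∈ V.gm n, Φ (V.D v) = A.d ∘ₗ Φ v - sgnz n • (Φ v ∘ₗ X.D)) ∧
    ∀ (x : A.R) (v : V.M), Φ (V.actL x v) = LinearMap.mul k A.R x ∘ₗ Φ v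

/-- The degree-`n` part of the complex `Hom_{Aᵒᵖ}(V, A)` of left `A`-module maps into `A`
(with Koszul signs for moving a degree-`n` map past a left action). -/
def lHomGrade (V : DGModL A) (n : ℤ) : Submodule k (V.M →ₗ[k] A.R) where
  carrier := {g | (∀ (j : ℤ), ∀ v ∈ V.gm j, g v ∈ A.gr (j + n)) ∧
    ∀ (i : ℤ) (x : A.R), x ∈ A.gr i → ∀ v : V.M, g (V.actL x v) = sgnz (i * n) • (x * g v)}
  add_mem' := by
    rintro f g ⟨hf1, hf2⟩ ⟨hg1, hg2⟩
    exact ⟨fun j v hv => (A.gr (j + n)).add_mem (hf1 j v hv) (hg1 j v hv),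
      fun i x hx v => by simp [hf2 i x hx, hg2 i x hx, mul_add, smul_add]⟩
  zero_mem' := ⟨fun j v hv => (A.gr (j + n)).zero_mem, fun i x hx v => by simp⟩
  smul_mem' := by
    rintro c f ⟨hf1, hf2⟩
    refine ⟨fun j v hv => (A.gr (j + n)).smul_mem c (hf1 j v hv), fun i x hx v => ?_⟩
    simp only [LinearMap.smul_apply, hf2 i x hx, Algebra.mul_smul_comm]
    rw [smul_comm]

/-- `W` realizes the bidual complex `Hom_{Aᵒᵖ}(V, A)` of a left DG module `V`,
as a right DG module. -/
def IsLeftDualOf (V : DGModL A) (W : DGMod A) : Prop :=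
  ∃ Ψ : W.M →ₗ[k] (V.M →ₗ[k] A.R),
    Function.Injective Ψ ∧
    (∀ n : ℤ, Submodule.map Ψ (W.gm n) = lHomGrade V n) ∧
    (∀ (n : ℤ), ∀ w ∈ W.gm n, Ψ (W.D w) = A.d ∘ₗ Ψ w - sgnz n • (Ψ w ∘ₗ V.D)) ∧
    ∀ (x : A.R) (w : W.M), Ψ (W.act x w) = (LinearMap.mul k A.R).flip x ∘ₗ Ψ w

/-- The degree-`j` part of the graded `k`-linear dual of a graded module:
functionals vanishing on all components of degree `≠ -j`. -/
def dualGrade {M : Type} [AddCommGroup M] [Module k M]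
    (gm : ℤ → Submodule k M) (j : ℤ) : Submodule k (M →ₗ[k] k) where
  carrier := {ν | ∀ l : ℤ, l ≠ -j → ∀ m ∈ gm l, ν m = 0}
  add_mem' := by
    intro f g hf hg l hl m hm
    simp [hf l hl m hm, hg l hl m hm]
  zero_mem' := by intro l hl m hm; simp
  smul_mem' := by
    intro c f hf l hl m hm
    simp [hf l hl m hm]

/-- `W` realizes the graded `k`-linear dual of a left DG module `V`, as a right DG
module (the Nakayama construction `V ↦ V^*`). -/
def IsGradedKDual (V : DGModL A) (W : DGMod A) : Prop :=
  ∃ Ψ : W.M →ₗ[k] (V.M →ₗ[k] k),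
    (∀ (n : ℤ), ∀ w ∈ W.gm n, Ψ w ∈ dualGrade V.gm n) ∧
    (∀ n : ℤ, Function.Bijective
      (fun w : ↥(W.gm n) => (Ψ ↑w) ∘ₗ (V.gm (-n)).subtype)) ∧
    (∀ (n : ℤ), ∀ w ∈ W.gm n, ∀ v : V.M, Ψ (W.D w) v = -(sgnz n) • Ψ w (V.D v)) ∧
    ∀ (i : ℤ) (x : A.R), x ∈ A.gr i → ∀ (n : ℤ), ∀ w ∈ W.gm n, ∀ v : V.M,
      Ψ (W.act x w) v = sgnz (i * n) • Ψ w (V.actL x v)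

/-- `W` realizes the Nakayama functor value `S_A(X) = (X^∨)^*`. -/
def IsNakayamaOf (X : DGMod A) (W : DGMod A) : Prop :=
  ∃ V : DGModL A, IsRightDualOf X V ∧ IsGradedKDual V W
/-! ### Graded tensor products, dual complexes, and bimodule Hom complexes -/

/-- The degree-`n` part of the tensor product of two graded modules. -/
def tenGrade {M₁ M₂ : Type} [AddCommGroup M₁] [Module k M₁] [AddCommGroup M₂] [Module k M₂]
    (gm₁ : ℤ → Submodule k M₁) (gm₂ : ℤ → Submodule k M₂) (n : ℤ) :
    Submodule k (M₁ ⊗[k] M₂) :=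
  Submodule.span k {t : M₁ ⊗[k] M₂ | ∃ (i j : ℤ) (x : M₁) (y : M₂),
    x ∈ gm₁ i ∧ y ∈ gm₂ j ∧ i + j = n ∧ t = x ⊗ₜ y}

/-- The differential `D₁ ⊗ 1 + σ₁ ⊗ D₂` on a tensor product of complexes, where `σ₁`
is the sign operator of the first factor. -/
def tenD {M₁ M₂ : Type} [AddCommGroup M₁] [Module k M₁] [AddCommGroup M₂] [Module k M₂]
    (D₁ : M₁ →ₗ[k] M₁) (s₁ : M₁ →ₗ[k] M₁) (D₂ : M₂ →ₗ[k] M₂) :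
    (M₁ ⊗[k] M₂) →ₗ[k] (M₁ ⊗[k] M₂) :=
  TensorProduct.map D₁ LinearMap.id + TensorProduct.map s₁ D₂

/-- Cycles of a quotient complex `M/K`, described by representatives in `M`. -/
def ZgK {M : Type} [AddCommGroup M] [Module k M]
    (gm : ℤ → Submodule k M) (Dm : M →ₗ[k] M) (K : Submodule k M) (n : ℤ) :
    Submodule k M :=
  gm n ⊓ K.comap Dm

/-- Boundaries of a quotient complex `M/K`, described by representatives in `M`. -/
def BgK {M : Type} [AddCommGroup M] [Module k M]
    (gm : ℤ → Submodule k M) (Dm : M →ₗ[k] M) (K : Submodule k M) (n : ℤ) :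
    Submodule k M :=
  gm n ⊓ (K ⊔ LinearMap.range Dm)

/-- The differential of the graded dual of a complex. -/
def dualD {M : Type} [AddCommGroup M] [Module k M]
    (gm : ℤ → Submodule k M) [DirectSum.Decomposition gm] (Dm : M →ₗ[k] M) :
    (M →ₗ[k] k) →ₗ[k] (M →ₗ[k] k) :=
  -((LinearMap.llcomp k M M k).flip (Dm ∘ₗ gop gm fun j => sgnk k (j + 1)))

/-- The left `A`-action on the dual `M^*` of a right DG `A`-module `M`. -/
def dualActL (M : DGMod A) (x : A.R) : (M.M →ₗ[k] k) →ₗ[k] (M.M →ₗ[k] k) :=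
  (LinearMap.llcomp k M.M M.M k).flip (M.act x)

/-- The relations submodule defining `X ⊗_A V` inside `X ⊗_k V` for a right module `X`
and a bimodule `V`. -/
def tenRelMB (X : DGMod A) (V : DGBimod A) : Submodule k (X.M ⊗[k] V.M) :=
  Submodule.span k {t : X.M ⊗[k] V.M | ∃ (a : A.R) (x : X.M) (v : V.M),
    t = (X.act a x) ⊗ₜ v - x ⊗ₜ (V.actL a v)}

/-- The relations submodule defining `U ⊗_A V` inside `U ⊗_k V` for two bimodules. -/
def tenRelBB (U V : DGBimod A) : Submodule k (U.M ⊗[k] V.M) :=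
  Submodule.span k {t : U.M ⊗[k] V.M | ∃ (a : A.R) (u : U.M) (v : V.M),
    t = (U.actR a u) ⊗ₜ v - u ⊗ₜ (V.actL a v)}

/-- `V` realizes the dual bimodule `A^* = Hom_k(A, k)` (with its canonical DG
`A`-bimodule structure induced from the diagonal bimodule `A`). -/
def IsDualDiagOf {A : DGAlgebra k} (V : DGBimod A) : Prop :=
  ∃ Ψ : V.M →ₗ[k] (A.R →ₗ[k] k),
    (∀ (n : ℤ), ∀ v ∈ V.gm n, Ψ v ∈ dualGrade A.gr n) ∧
    (∀ n : ℤ, Function.Bijective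
      (fun v : ↥(V.gm n) => (Ψ ↑v) ∘ₗ (A.gr (-n)).subtype)) ∧
    (∀ (n : ℤ), ∀ v ∈ V.gm n, ∀ b : A.R, Ψ (V.D v) b = -(sgnz n) • Ψ v (A.d b)) ∧
    (∀ (i : ℤ) (x : A.R), x ∈ A.gr i → ∀ (n : ℤ), ∀ v ∈ V.gm n, ∀ b : A.R,
      Ψ (V.actL x v) b = sgnz (i * n) • Ψ v (b * x)) ∧
    ∀ (x : A.R) (v : V.M) (b : A.R), Ψ (V.actR x v) b = Ψ v (x * b)

/-- The degree-`n` part of the bimodule Hom complex `Hom_{Aᵉ}(P, T)`, for a target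
complex `T` equipped with (degreewise) commuting `Aᵉ`-actions `actLT`, `actRT`. -/
def bheGrade (P : DGBimod A) {T : Type} [AddCommGroup T] [Module k T]
    (gmT : ℤ → Submodule k T) (actLT actRT : ℤ → A.R → T →ₗ[k] T) (n : ℤ) :
    Submodule k (P.M →ₗ[k] T) where
  carrier := {g | (∀ (j : ℤ), ∀ m ∈ P.gm j, g m ∈ gmT (j + n)) ∧
    (∀ (i : ℤ) (x : A.R), x ∈ A.gr i → ∀ m : P.M,
      g (P.actL x m) = sgnz (i * n) • actLT i x (g m)) ∧
    ∀ (i : ℤ) (x : A.R), x ∈ A.gr i → ∀ m : P.M, g (P.actR x m) = actRT i x (g m)}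
  add_mem' := by
    rintro f g ⟨hf1, hf2, hf3⟩ ⟨hg1, hg2, hg3⟩
    exact ⟨fun j m hm => (gmT (j + n)).add_mem (hf1 j m hm) (hg1 j m hm),
      fun i x hx m => by simp [hf2 i x hx, hg2 i x hx, smul_add],
      fun i x hx m => by simp [hf3 i x hx, hg3 i x hx]⟩
  zero_mem' := ⟨fun j m hm => (gmT (j + n)).zero_mem,
    fun i x hx m => by simp, fun i x hx m => by simp⟩
  smul_mem' := by
    rintro c f ⟨hf1, hf2, hf3⟩
    refine ⟨fun j m hm => (gmT (j + n)).smul_mem c (hf1 j m hm), fun i x hx m => ?_,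
      fun i x hx m => by simp [hf3 i x hx]⟩
    simp only [LinearMap.smul_apply, hf2 i x hx, map_smul]
    rw [smul_comm]

/-- The differential of the bimodule Hom complex in degree `n`. -/
def bhDop (P : DGBimod A) {T : Type} [AddCommGroup T] [Module k T]
    (DT : T →ₗ[k] T) (n : ℤ) : (P.M →ₗ[k] T) →ₗ[k] (P.M →ₗ[k] T) :=
  (LinearMap.llcomp k P.M T T) DT - sgnz n • (LinearMap.llcomp k P.M P.M T).flip P.D

/-- Closed degree-`n` elements of the bimodule Hom complex. -/
def ZbhS (P : DGBimod A) {T : Type} [AddCommGroup T] [Module k T]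
    (gmT : ℤ → Submodule k T) (actLT actRT : ℤ → A.R → T →ₗ[k] T)
    (DT : T →ₗ[k] T) (n : ℤ) : Submodule k (P.M →ₗ[k] T) :=
  bheGrade P gmT actLT actRT n ⊓ LinearMap.ker (bhDop P DT n)

/-- Boundaries of degree `n` of the bimodule Hom complex. -/
def BbhS (P : DGBimod A) {T : Type} [AddCommGroup T] [Module k T]
    (gmT : ℤ → Submodule k T) (actLT actRT : ℤ → A.R → T →ₗ[k] T)
    (DT : T →ₗ[k] T) (n : ℤ) : Submodule k (P.M →ₗ[k] T) :=
  Submodule.map (bhDop P DT (n - 1)) (bheGrade P gmT actLT actRT (n - 1))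

/-- Cohomology of the bimodule Hom complex (`Ext` over `Aᵉ`). -/
def ExtBSpace (P : DGBimod A) {T : Type} [AddCommGroup T] [Module k T]
    (gmT : ℤ → Submodule k T) (actLT actRT : ℤ → A.R → T →ₗ[k] T)
    (DT : T →ₗ[k] T) (n : ℤ) : Type :=
  ↥(ZbhS P gmT actLT actRT DT n) ⧸
    (Submodule.comap (ZbhS P gmT actLT actRT DT n).subtype
      (BbhS P gmT actLT actRT DT n ⊓ ZbhS P gmT actLT actRT DT n))

instance (P : DGBimod A) {T : Type} [AddCommGroup T] [Module k T]
    (gmT : ℤ → Submodule k T) (actLT actRT : ℤ → A.R → T →ₗ[k] T)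
    (DT : T →ₗ[k] T) (n : ℤ) : AddCommGroup (ExtBSpace P gmT actLT actRT DT n) := by
  unfold ExtBSpace; infer_instance

instance (P : DGBimod A) {T : Type} [AddCommGroup T] [Module k T]
    (gmT : ℤ → Submodule k T) (actLT actRT : ℤ → A.R → T →ₗ[k] T)
    (DT : T →ₗ[k] T) (n : ℤ) : Module k (ExtBSpace P gmT actLT actRT DT n) := by
  unfold ExtBSpace; infer_instance

/-- The differential of `Aᵉ` on the underlying space `A.R ⊗[k] A.R`. -/
def aeD (A : DGAlgebra k) : (A.R ⊗[k] A.R) →ₗ[k] (A.R ⊗[k] A.R) :=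
  tenD A.d (gop A.gr fun j => sgnk k j) A.d

/-- The inner (module) action of a homogeneous element of degree `i` on the left slot
of the free `Aᵉ`-module `Aᵉ`. -/
def aeInnerL (A : DGAlgebra k) (i : ℤ) (x : A.R) : (A.R ⊗[k] A.R) →ₗ[k] (A.R ⊗[k] A.R) :=
  TensorProduct.map (LinearMap.mulLeft k x) (gop A.gr fun j => sgnk k (i * j))

/-- The inner (module) action on the right slot of the free `Aᵉ`-module `Aᵉ`. -/
def aeInnerR (A : DGAlgebra k) (i : ℤ) (x : A.R) : (A.R ⊗[k] A.R) →ₗ[k] (A.R ⊗[k] A.R) :=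
  TensorProduct.map LinearMap.id (LinearMap.mulRight k x)

/-- The outer left action on the free `Aᵉ`-module `Aᵉ`. -/
def aeOuterL (A : DGAlgebra k) (i : ℤ) (x : A.R) : (A.R ⊗[k] A.R) →ₗ[k] (A.R ⊗[k] A.R) :=
  TensorProduct.map (LinearMap.mulRight k x) LinearMap.id

/-- The outer right action on the free `Aᵉ`-module `Aᵉ`. -/
def aeOuterR (A : DGAlgebra k) (i : ℤ) (x : A.R) : (A.R ⊗[k] A.R) →ₗ[k] (A.R ⊗[k] A.R) :=
  TensorProduct.map (gop A.gr fun j => sgnk k (i * j)) (LinearMap.mulLeft k x)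

/-- `E` represents the inverse dualizing bimodule
`A^! = RHom_{(Aᵉ)ᵒᵖ}(A, (Aᵉ)ᵒᵖ)`: `E` is identified, via `Φ`, with the bimodule Hom
complex `Hom_{Aᵉ}(P, Aᵉ)` for an h-projective bimodule resolution `P` of the diagonal. -/
def RepresentsShriek {A : DGAlgebra k} (E : DGBimod A) : Prop :=
  ∃ (P : DGBimod A) (F : BimodHom P (diagBimod A)), IsDiagResolution P F ∧
  ∃ Φ : E.M →ₗ[k] (P.M →ₗ[k] (A.R ⊗[k] A.R)),
    Function.Injective Φ ∧
    (∀ n : ℤ, Submodule.map Φ (E.gm n) =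
      bheGrade P (tenGrade A.gr A.gr) (aeInnerL A) (aeInnerR A) n) ∧
    (∀ (n : ℤ), ∀ v ∈ E.gm n, Φ (E.D v) = bhDop P (aeD A) n (Φ v)) ∧
    (∀ (i : ℤ) (x : A.R), x ∈ A.gr i → ∀ v : E.M,
      Φ (E.actL x v) = aeOuterL A i x ∘ₗ Φ v) ∧
    ∀ (i : ℤ) (x : A.R), x ∈ A.gr i → ∀ v : E.M,
      Φ (E.actR x v) = aeOuterR A i x ∘ₗ Φ v


lemma sgnz_add (i j : ℤ) : sgnz (i + j) = sgnz i * sgnz j := by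
  unfold sgnz
  by_cases hi : Even i <;> by_cases hj : Even j <;> simp [hi, hj, Int.even_add]

lemma sgnz_mul_self (i : ℤ) : sgnz i * sgnz i = 1 := by
  unfold sgnz; split_ifs <;> simp

lemma sgnz_smul_smul {M : Type} [AddCommGroup M] (i : ℤ) (m : M) :
    sgnz i • sgnz i • m = m := by
  rw [smul_smul, sgnz_mul_self, one_smul]

lemma sgnz_one : sgnz 1 = -1 := by simp [sgnz]

lemma sgnz_neg (i : ℤ) : sgnz (-i) = sgnz i := by simp [sgnz]

lemma sgnk_smul {M : Type} [AddCommGroup M] [Module k M] (i : ℤ) (m : M) :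
    sgnk k i • m = sgnz i • m := by
  unfold sgnk sgnz; split_ifs <;> simp

section grading
variable {M : Type} [AddCommGroup M] [Module k M] (gm : ℤ → Submodule k M)
  [DirectSum.Decomposition gm]

lemma hind {p : M → Prop} (h0 : p 0) (hadd : ∀ a b, p a → p b → p (a + b))
    (hom : ∀ i, ∀ m ∈ gm i, p m) : ∀ m, p m := fun m =>
  DirectSum.Decomposition.inductionOn gm h0 (fun {i} m => hom i m m.2) (fun a b => hadd a b) m

/-- projection to the degree `n` component -/
def pr (n : ℤ) : M →ₗ[k] M :=
  (gm n).subtype ∘ₗ DirectSum.component k ℤ (fun i => ↥(gm i)) n ∘ₗ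
    (DirectSum.decomposeLinearEquiv gm).toLinearMap

lemma pr_apply (n : ℤ) (m : M) : pr gm n m = (DirectSum.decompose gm m n : M) := rfl

lemma pr_mem (n : ℤ) (m : M) : pr gm n m ∈ gm n := by
  rw [pr_apply]; exact SetLike.coe_mem _

lemma pr_same {n : ℤ} {m : M} (h : m ∈ gm n) : pr gm n m = m := by
  rw [pr_apply, DirectSum.decompose_of_mem_same gm h]

lemma pr_ne {n i : ℤ} {m : M} (h : m ∈ gm i) (hn : i ≠ n) : pr gm n m = 0 := by
  rw [pr_apply, DirectSum.decompose_of_mem_ne gm h hn]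

lemma gop_apply (c : ℤ → k) {j : ℤ} {m : M} (h : m ∈ gm j) : gop gm c m = c j • m := by
  unfold gop
  simp only [LinearMap.comp_apply, LinearEquiv.coe_coe, DirectSum.decomposeLinearEquiv_apply]
  rw [DirectSum.decompose_of_mem gm h]
  erw [DirectSum.toModule_lof]
  simp

lemma pr_shift {N : Type} [AddCommGroup N] [Module k N] (gn : ℤ → Submodule k N)
    [DirectSum.Decomposition gn] (f : M →ₗ[k] N) (c : ℤ)
    (hf : ∀ j, ∀ m ∈ gm j, f m ∈ gn (j + c)) (n : ℤ) (m : M) :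
    pr gn (n + c) (f m) = f (pr gm n m) := by
  revert m
  refine hind gm ?_ ?_ ?_
  · simp
  · intro a b ha hb; simp [ha, hb]
  · intro i m hm
    by_cases h : i = n
    · subst h; rw [pr_same gm hm, pr_same gn (hf _ _ hm)]
    · rw [pr_ne gm hm h, pr_ne gn (hf _ _ hm) (by simpa using h), map_zero]

lemma exists_pre_deg (D : M →ₗ[k] M) (hD : ∀ j, ∀ m ∈ gm j, D m ∈ gm (j + 1)) {n : ℤ} {y : M}
    (hy : y ∈ gm (n + 1)) (h : y ∈ LinearMap.range D) : ∃ x ∈ gm n, D x = y := by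
  obtain ⟨x, rfl⟩ := h
  refine ⟨pr gm n x, pr_mem gm n x, ?_⟩
  rw [← pr_shift gm gm D 1 hD, pr_same gm hy]

end grading

/-- decomposition from projections -/
@[reducible] def decompOfProj {M : Type} [AddCommGroup M] [Module k M] (gm : ℤ → Submodule k M)
    (p : ℤ → M →ₗ[k] M) (h1 : ∀ n, ∀ m ∈ gm n, p n m = m)
    (h2 : ∀ n i, i ≠ n → ∀ m ∈ gm i, p n m = 0) (h3 : ∀ m, m ∈ iSup gm) :
    DirectSum.Decomposition gm := by
  refine DirectSum.IsInternal.chooseDecomposition gm ?_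
  rw [DirectSum.isInternal_submodule_iff_iSupIndep_and_iSup_eq_top]
  refine ⟨?_, ?_⟩
  · intro n
    rw [Submodule.disjoint_def]
    intro m hm hm'
    have : (⨆ j, ⨆ (_ : j ≠ n), gm j) ≤ LinearMap.ker (p n) := by
      refine iSup_le fun j => iSup_le fun hj => ?_
      intro m hm
      exact h2 n j hj m hm
    rw [← h1 n m hm]
    exact this hm'
  · rw [eq_top_iff]; intro m _; exact h3 m

/-! bimodule leibniz rules without homogeneity -/

lemma leibL (X : DGBimod A) {i : ℤ} {x : A.R} (hx : x ∈ A.gr i) (m : X.M) :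
    X.D (X.actL x m) = X.actL (A.d x) m + sgnz i • X.actL x (X.D m) := by
  revert m
  refine hind X.gm ?_ ?_ ?_
  · simp
  · intro a b ha hb; simp only [map_add, ha, hb, smul_add]; abel
  · intro j m hm; exact X.leibnizL i j x m hx hm

lemma leibR (X : DGBimod A) {j : ℤ} {m : X.M} (hm : m ∈ X.gm j) (x : A.R) :
    X.D (X.actR x m) = X.actR x (X.D m) + sgnz j • X.actR (A.d x) m := by
  revert x
  refine hind A.gr ?_ ?_ ?_
  · simp
  · intro a b ha hb; simp only [map_add, LinearMap.add_apply, ha, hb, smul_add]; abel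
  · intro i x hx; exact X.leibnizR i j x m hx hm

lemma biact_tmul (N : DGBimod A) {i l : ℤ} {a : A.R} (ha : a ∈ A.gr i) (b : A.R) {w : N.M}
    (hw : w ∈ N.gm l) : biact N (a ⊗ₜ b) w = sgnz (i * l) • N.actL a (N.actR b w) := by
  unfold biact
  simp only [TensorProduct.lift.tmul, LinearMap.comp_apply, LinearEquiv.coe_coe,
    DirectSum.decomposeLinearEquiv_apply]
  rw [DirectSum.decompose_of_mem A.gr ha]
  erw [DirectSum.toModule_lof]
  simp only [biactAux, LinearMap.coe_mk, AddHom.coe_mk, LinearMap.comp_apply]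
  rw [gop_apply N.gm _ hw]
  simp [sgnk_smul]

/-- tensor induction with homogeneous left factor -/
lemma tind {p : A.R ⊗[k] A.R → Prop} (h0 : p 0) (hadd : ∀ a b, p a → p b → p (a + b))
    (hom : ∀ i j, ∀ a ∈ A.gr i, ∀ b ∈ A.gr j, p (a ⊗ₜ b)) : ∀ t, p t := by
  intro t
  induction t with
  | zero => exact h0
  | add a b ha hb => exact hadd a b ha hb
  | tmul a b =>
    revert a
    refine hind A.gr ?_ ?_ ?_
    · simpa using h0
    · intro a a' ha ha'; rw [TensorProduct.add_tmul]; exact hadd _ _ ha ha'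
    · intro i a ha
      revert b
      refine hind A.gr ?_ ?_ ?_
      · simpa using h0
      · intro b b' hb hb'; rw [TensorProduct.tmul_add]; exact hadd _ _ hb hb'
      · intro j b hb; exact hom i j a ha b hb

/-- left multiplication on `A ⊗ A` -/
def tL (x : A.R) : A.R ⊗[k] A.R →ₗ[k] A.R ⊗[k] A.R :=
  TensorProduct.map (LinearMap.mulLeft k x) LinearMap.id
/-- right multiplication on `A ⊗ A` -/
def tR (x : A.R) : A.R ⊗[k] A.R →ₗ[k] A.R ⊗[k] A.R :=
  TensorProduct.map LinearMap.id (LinearMap.mulRight k x)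

lemma biact_tL (N : DGBimod A) {i l : ℤ} {x : A.R} (hx : x ∈ A.gr i) {w : N.M}
    (hw : w ∈ N.gm l) (t) :
    N.actL x (biact N t w) = sgnz (i * l) • biact N (tL x t) w := by
  revert t
  refine tind ?_ ?_ ?_
  · simp
  · intro a b ha hb; simp only [map_add, LinearMap.add_apply, ha, hb, smul_add]
  · intro p q a ha b hb
    rw [biact_tmul N ha b hw]
    simp only [tL, TensorProduct.map_tmul, LinearMap.mulLeft_apply, LinearMap.id_apply]
    rw [biact_tmul N (A.mul_mem hx ha) b hw, N.actL_mul, add_mul, sgnz_add, map_zsmul, mul_smul,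
      sgnz_smul_smul]

lemma biact_tR (N : DGBimod A) {l : ℤ} (x : A.R) {w : N.M}
    (hw : w ∈ N.gm l) (t) :
    N.actR x (biact N t w) = biact N (tR x t) w := by
  revert t
  refine tind ?_ ?_ ?_
  · simp
  · intro a b ha hb; simp only [map_add, LinearMap.add_apply, ha, hb]
  · intro p q a ha b hb
    rw [biact_tmul N ha b hw]
    simp only [tR, TensorProduct.map_tmul, LinearMap.mulRight_apply, LinearMap.id_apply]
    rw [biact_tmul N ha _ hw, N.actR_mul, map_zsmul, N.actLR, N.actLR, N.actLR]


/-! mapping cone -/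

/-- grading of the cone -/
def coneG {Y Z : DGBimod A} (j : ℤ) : Submodule k (Z.M × Y.M) :=
  (Z.gm j).prod (Y.gm (j + 1))

lemma mem_coneG {Y Z : DGBimod A} {j : ℤ} {m : Z.M × Y.M} :
    m ∈ coneG (Y := Y) (Z := Z) j ↔ m.1 ∈ Z.gm j ∧ m.2 ∈ Y.gm (j + 1) := by
  simp [coneG, Submodule.mem_prod]

/-- decomposition of the cone -/
@[reducible] def coneDec (Y Z : DGBimod A) :
    DirectSum.Decomposition (coneG (Y := Y) (Z := Z)) := by
  refine decompOfProj _ (fun n => LinearMap.prodMap (pr Z.gm n) (pr Y.gm (n + 1))) ?_ ?_ ?_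
  · intro n m hm
    rw [mem_coneG] at hm
    ext <;> simp [pr_same _ hm.1, pr_same _ hm.2]
  · intro n i hi m hm
    rw [mem_coneG] at hm
    ext
    · simp [pr_ne _ hm.1 hi]
    · simp [pr_ne (n := n + 1) _ hm.2 (by simpa using hi)]
  · rintro ⟨z, y⟩
    have h1 : ((z, 0) : Z.M × Y.M) ∈ iSup (coneG (Y := Y) (Z := Z)) := by
      revert z
      refine hind Z.gm ?_ ?_ ?_
      · exact zero_mem _
      · intro a b ha hb
        have := add_mem ha hb
        simpa using this
      · intro i m hm
        refine Submodule.mem_iSup_of_mem i ?_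
        rw [mem_coneG]; exact ⟨hm, zero_mem _⟩
    have h2 : ((0, y) : Z.M × Y.M) ∈ iSup (coneG (Y := Y) (Z := Z)) := by
      revert y
      refine hind Y.gm ?_ ?_ ?_
      · exact zero_mem _
      · intro a b ha hb
        have := add_mem ha hb
        simpa using this
      · intro i m hm
        refine Submodule.mem_iSup_of_mem (i - 1) ?_
        rw [mem_coneG]; exact ⟨zero_mem _, by simpa using hm⟩
    have := add_mem h1 h2
    simpa using this

/-- the sign automorphism of `A` -/
def sg (A : DGAlgebra k) : A.R →ₗ[k] A.R := gop A.gr (fun j => sgnk k j)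

lemma sg_apply {i : ℤ} {x : A.R} (hx : x ∈ A.gr i) : sg A x = sgnz i • x := by
  rw [sg, gop_apply _ _ hx, sgnk_smul]

lemma sg_mul (x y : A.R) : sg A (x * y) = sg A x * sg A y := by
  revert x
  refine hind A.gr ?_ ?_ ?_
  · simp
  · intro a b ha hb; simp [add_mul, ha, hb]
  · intro i x hx
    revert y
    refine hind A.gr ?_ ?_ ?_
    · simp
    · intro a b ha hb; simp [mul_add, ha, hb]
    · intro j y hy
      rw [sg_apply hx, sg_apply hy, sg_apply (A.mul_mem hx hy), sgnz_add]
      rw [smul_mul_smul_comm]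

lemma sg_one : sg A 1 = 1 := by
  rw [sg_apply A.one_mem]; simp [sgnz]

/-- the mapping cone `Z ⊕ Y[1]` -/
def cone {Y Z : DGBimod A} (G : BimodHom Y Z) : DGBimod A where
  M := Z.M × Y.M
  gm := coneG
  dec := coneDec Y Z
  actL :=
    { toFun := fun x => LinearMap.prodMap (Z.actL x) (Y.actL (sg A x))
      map_add' := by intro x y; ext <;> simp
      map_smul' := by intro x y; ext <;> simp }
  actR :=
    { toFun := fun x => LinearMap.prodMap (Z.actR x) (Y.actR x)
      map_add' := by intro x y; ext <;> simp
      map_smul' := by intro x y; ext <;> simp }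
  actL_one := by intro m; ext <;> simp [sg_one, Z.actL_one, Y.actL_one]
  actR_one := by intro m; ext <;> simp [Z.actR_one, Y.actR_one]
  actL_mul := by intro x y m; ext <;> simp [sg_mul, Z.actL_mul, Y.actL_mul]
  actR_mul := by intro x y m; ext <;> simp [Z.actR_mul, Y.actR_mul]
  actLR := by intro x y m; ext <;> simp [Z.actLR, Y.actLR]
  actL_deg := by
    intro i j x m hx hm
    rw [mem_coneG] at hm ⊢
    refine ⟨Z.actL_deg i j x _ hx hm.1, ?_⟩
    have := Y.actL_deg i (j + 1) x _ hx hm.2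
    simp only [LinearMap.coe_mk, AddHom.coe_mk, LinearMap.prodMap_apply, sg_apply hx]
    rw [map_zsmul, LinearMap.smul_apply, add_assoc]
    exact zsmul_mem this _
  actR_deg := by
    intro i j x m hx hm
    rw [mem_coneG] at hm ⊢
    refine ⟨Z.actR_deg i j x _ hx hm.1, ?_⟩
    have := Y.actR_deg i (j + 1) x _ hx hm.2
    rwa [show j + 1 + i = j + i + 1 by ring] at this
  D := LinearMap.prod (Z.D ∘ₗ LinearMap.fst k _ _ + G.f ∘ₗ LinearMap.snd k _ _)
    (-(Y.D ∘ₗ LinearMap.snd k _ _))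
  D_deg := by
    intro j m hm
    rw [mem_coneG] at hm ⊢
    refine ⟨?_, ?_⟩
    · exact add_mem (Z.D_deg _ _ hm.1) (G.deg _ _ hm.2)
    · exact neg_mem (Y.D_deg _ _ hm.2)
  D_sq := by
    intro m
    ext
    · simp [Z.D_sq, G.comm]
    · simp [Y.D_sq]
  leibnizL := by
    rintro i j x ⟨z, y⟩ hx hm
    have hdx := sg_apply (A.d_deg i x hx)
    change ((Z.D (Z.actL x z) + G.f (Y.actL (sg A x) y), -(Y.D (Y.actL (sg A x) y))) : Z.M × Y.M)
      = (Z.actL (A.d x) z, Y.actL (sg A (A.d x)) y) +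
        sgnz i • ((Z.actL x (Z.D z + G.f y), Y.actL (sg A x) (-(Y.D y))) : Z.M × Y.M)
    ext
    · simp only [Prod.fst_add, Prod.smul_fst, leibL Z hx, G.actLc, sg_apply hx,
        map_add, smul_add, map_zsmul, LinearMap.smul_apply]
      abel
    · simp only [Prod.snd_add, Prod.smul_snd, sg_apply hx, hdx,
        smul_add, map_zsmul, LinearMap.smul_apply, map_neg, sgnz_add, sgnz_one, leibL Y hx]
      simp only [smul_neg, mul_neg, mul_one, neg_smul]
      abel
  leibnizR := by
    rintro i j x ⟨z, y⟩ hx hm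
    rw [mem_coneG] at hm
    change ((Z.D (Z.actR x z) + G.f (Y.actR x y), -(Y.D (Y.actR x y))) : Z.M × Y.M)
      = (Z.actR x (Z.D z + G.f y), Y.actR x (-(Y.D y))) +
        sgnz j • ((Z.actR (A.d x) z, Y.actR (A.d x) y) : Z.M × Y.M)
    ext
    · simp only [Prod.fst_add, Prod.smul_fst, leibR Z hm.1, G.actRc, map_add]
      abel
    · simp only [Prod.snd_add, Prod.smul_snd, leibR Y hm.2, map_neg, sgnz_add, sgnz_one]
      simp only [mul_neg, mul_one, neg_smul]
      abel

lemma cone_acyclic {Y Z : DGBimod A} (G : BimodHom Y Z) (hG : QIsoData Y.gm Y.D Z.gm Z.D G.f) :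
    AcyclicB (cone G) := by
  rintro n ⟨z, y⟩ ⟨hm, hD⟩
  refine ⟨hm, ?_⟩
  have hm' := mem_coneG.1 hm
  obtain ⟨hz, hy⟩ := hm'
  simp only at hz hy
  have hD' : ((Z.D z + G.f y, -(Y.D y)) : Z.M × Y.M) = 0 := hD
  rw [Prod.mk_eq_zero, neg_eq_zero] at hD'
  obtain ⟨e1, e2⟩ := hD'
  obtain ⟨g1, g2, g3⟩ := hG
  have hyB : y ∈ Bg Y.gm Y.D (n + 1) := by
    refine (g3 (n + 1)).2 y ⟨hy, e2⟩ ⟨G.deg _ _ hy, -z, ?_⟩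
    rw [map_neg]; exact (eq_neg_of_add_eq_zero_right e1).symm
  obtain ⟨y', hy', rfl⟩ := exists_pre_deg Y.gm Y.D Y.D_deg hy hyB.2
  obtain ⟨w, hw, hw'⟩ := (g3 n).1 (z + G.f y')
    ⟨add_mem hz (G.deg _ _ hy'), by
      rw [SetLike.mem_coe, LinearMap.mem_ker, map_add, ← G.comm]; exact e1⟩
  obtain ⟨_, z', hz'⟩ := hw'
  have hwD : Y.D w = 0 := hw.2
  refine ⟨((-z', w - y') : Z.M × Y.M), ?_⟩
  change ((Z.D (-z') + G.f (w - y'), -(Y.D (w - y'))) : Z.M × Y.M) = (z, Y.D y')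
  ext
  · simp [hz']
  · simp [hwD]

lemma lift_qis {X Y Z : DGBimod A} (hX : IsHoProjB X) (G : BimodHom Y Z)
    (hG : QIsoData Y.gm Y.D Z.gm Z.D G.f) (f : BimodHom X Z) :
    ∃ φ : BimodHom X Y, BimodHomotopic f (G.comp φ) := by
  let f' : BimodHom X (cone G) :=
    { f := LinearMap.prod f.f 0
      deg := fun j m hm => mem_coneG.2 ⟨f.deg j m hm, zero_mem _⟩
      actLc := by
        intro x m
        change ((f.f (X.actL x m), 0) : Z.M × Y.M) = (Z.actL x (f.f m), Y.actL (sg A x) 0)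
        rw [f.actLc, map_zero]
      actRc := by
        intro x m
        change ((f.f (X.actR x m), 0) : Z.M × Y.M) = (Z.actR x (f.f m), Y.actR x 0)
        rw [f.actRc, map_zero]
      comm := by
        intro m
        change ((f.f (X.D m), 0) : Z.M × Y.M) = (Z.D (f.f m) + G.f 0, - Y.D 0)
        simp [f.comm] }
  obtain ⟨h, h1, h2, h3, h4⟩ := hX (cone G) (cone_acyclic G hG) f'
  let ha : X.M →ₗ[k] Z.M := LinearMap.fst k Z.M Y.M ∘ₗ h
  let hb : X.M →ₗ[k] Y.M := LinearMap.snd k Z.M Y.M ∘ₗ h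
  have hh : ∀ m, h m = ((ha m, hb m) : Z.M × Y.M) := fun m => rfl
  have key : ∀ m, ((f.f m, 0) : Z.M × Y.M) =
      ((Z.D (ha m) + G.f (hb m) + ha (X.D m), - Y.D (hb m) + hb (X.D m)) : Z.M × Y.M) := by
    intro m
    have h5 : f'.f m = (cone G).D (h m) + h (X.D m) := by
      rw [← h4 m]
      change _ = _ - (0 : (cone G).M)
      rw [sub_zero]
    exact h5
  have hbL : ∀ (x : A.R) (m : X.M), hb (X.actL x m) = Y.actL x (hb m) := by
    intro x m
    revert x
    refine hind A.gr ?_ ?_ ?_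
    · simp
    · intro a b ha hb; simp [ha, hb]
    · intro i x hx
      have h5 := congrArg (Prod.snd : Z.M × Y.M → Y.M) (h2 i x hx m)
      change hb (X.actL x m) = sgnz i • Y.actL (sg A x) (hb m) at h5
      rw [h5, sg_apply hx, map_zsmul, LinearMap.smul_apply, sgnz_smul_smul]
  refine ⟨⟨hb, ?_, hbL, ?_, ?_⟩, ha, ?_, ?_, ?_, ?_⟩
  · intro j m hm
    have := (mem_coneG.1 (h1 j m hm)).2
    rwa [sub_add_cancel] at this
  · intro x m
    exact congrArg (Prod.snd : Z.M × Y.M → Y.M) (h3 x m)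
  · intro m
    have := congrArg Prod.snd (key m)
    simp only at this
    exact (neg_add_eq_zero.1 this.symm).symm
  · intro j m hm
    exact (mem_coneG.1 (h1 j m hm)).1
  · intro i x hx m
    exact congrArg (Prod.fst : Z.M × Y.M → Z.M) (h2 i x hx m)
  · intro x m
    exact congrArg (Prod.fst : Z.M × Y.M → Z.M) (h3 x m)
  · intro m
    have := congrArg Prod.fst (key m)
    simp only at this
    rw [this]
    simp only [BimodHom.comp, LinearMap.comp_apply]
    abel

lemma ho_symm {X Y : DGBimod A} {F G : BimodHom X Y} (h : BimodHomotopic F G) :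
    BimodHomotopic G F := by
  obtain ⟨h, h1, h2, h3, h4⟩ := h
  refine ⟨-h, fun j m hm => neg_mem (h1 j m hm), ?_, ?_, ?_⟩
  · intro i x hx m; simp [h2 i x hx]
  · intro x m; simp [h3]
  · intro m
    rw [← neg_sub, h4]; simp; abel

lemma ho_trans {X Y : DGBimod A} {F G H : BimodHom X Y} (h : BimodHomotopic F G)
    (h' : BimodHomotopic G H) : BimodHomotopic F H := by
  obtain ⟨h, h1, h2, h3, h4⟩ := h
  obtain ⟨h', h1', h2', h3', h4'⟩ := h'
  refine ⟨h + h', fun j m hm => add_mem (h1 j m hm) (h1' j m hm), ?_, ?_, ?_⟩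
  · intro i x hx m; simp [h2 i x hx, h2' i x hx]
  · intro x m; simp [h3, h3']
  · intro m
    rw [← sub_add_sub_cancel _ (G.f m), h4, h4']; simp; abel

lemma ho_postcomp {X Y Z : DGBimod A} {F G : BimodHom X Y} (K : BimodHom Y Z)
    (h : BimodHomotopic F G) : BimodHomotopic (K.comp F) (K.comp G) := by
  obtain ⟨h, h1, h2, h3, h4⟩ := h
  refine ⟨K.f ∘ₗ h, fun j m hm => K.deg _ _ (h1 j m hm), ?_, ?_, ?_⟩
  · intro i x hx m; simp [h2 i x hx, K.actLc]
  · intro x m; simp [h3, K.actRc]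
  · intro m
    simp only [BimodHom.comp, LinearMap.comp_apply]
    rw [← map_sub, h4, map_add, K.comm]

lemma ho_precomp {X Y Z : DGBimod A} {F G : BimodHom Y Z} (K : BimodHom X Y)
    (h : BimodHomotopic F G) : BimodHomotopic (F.comp K) (G.comp K) := by
  obtain ⟨h, h1, h2, h3, h4⟩ := h
  refine ⟨h ∘ₗ K.f, fun j m hm => h1 _ _ (K.deg j m hm), ?_, ?_, ?_⟩
  · intro i x hx m; simp [h2 i x hx, K.actLc]
  · intro x m; simp [h3, K.actRc]
  · intro m
    simp only [BimodHom.comp, LinearMap.comp_apply]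
    rw [h4, K.comm]

/-- If `F` is a quasi-isomorphism and `F ∘ w ∼ F` then `w` is a quasi-isomorphism. -/
lemma qis_of_comp {P N : DGBimod A} (F : BimodHom P N) (hF : QIsoData P.gm P.D N.gm N.D F.f)
    (w : BimodHom P P) (hw : BimodHomotopic (F.comp w) F) :
    QIsoData P.gm P.D P.gm P.D w.f := by
  obtain ⟨h, h1, h2, h3, h4⟩ := hw
  obtain ⟨g1, g2, g3⟩ := hF
  have hZ : ∀ n, ∀ x ∈ Zg P.gm P.D n, w.f x ∈ Zg P.gm P.D n := by
    rintro n x ⟨hx, hx'⟩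
    refine ⟨w.deg _ _ hx, ?_⟩
    rw [SetLike.mem_coe, LinearMap.mem_ker] at hx' ⊢
    rw [← w.comm, hx', map_zero]
  have key : ∀ n, ∀ x ∈ Zg P.gm P.D n, w.f x - x ∈ Bg P.gm P.D n := by
    intro n x hx
    refine (g3 n).2 _ (sub_mem (hZ n x hx) hx) ⟨F.deg _ _ (sub_mem (w.deg _ _ hx.1) hx.1), h x, ?_⟩
    have h5 := h4 x
    have h6 : P.D x = 0 := hx.2
    rw [h6, map_zero, add_zero] at h5
    rw [← h5, map_sub]; rfl
  refine ⟨hZ, ?_, fun n => ⟨?_, ?_⟩⟩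
  · rintro n x ⟨hx, y, rfl⟩
    exact ⟨w.deg _ _ hx, w.f y, (w.comm y).symm⟩
  · intro z hz; exact ⟨z, hz, key n z hz⟩
  · intro z hz hz'
    have := sub_mem hz' (key n z hz)
    simpa using this

/-- `P` is a homotopy retract of `T`. -/
lemma retract {N P Q T : DGBimod A} (F : BimodHom P N) (hP : IsHoProjB P)
    (hF : QIsoData P.gm P.D N.gm N.D F.f) (hT : IsHoProjB T) (hQ : IsHoSummandB Q T)
    (G : BimodHom Q N) (hG : QIsoData Q.gm Q.D N.gm N.D G.f) : IsHoSummandB P T := by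
  obtain ⟨ι, ρ, hρ⟩ := hQ
  obtain ⟨φ, hφ⟩ := lift_qis hP G hG F
  obtain ⟨β, hβ⟩ := lift_qis hT F hF (G.comp ρ)
  have h1 : BimodHomotopic (F.comp (β.comp (ι.comp φ))) F := by
    have a1 : BimodHomotopic (F.comp (β.comp (ι.comp φ))) ((G.comp ρ).comp (ι.comp φ)) :=
      ho_precomp (ι.comp φ) (ho_symm hβ)
    have a2 : BimodHomotopic ((G.comp ρ).comp (ι.comp φ)) (G.comp φ) :=
      ho_precomp φ (ho_postcomp G hρ)
    exact ho_trans (ho_trans a1 a2) (ho_symm hφ)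
  obtain ⟨w', hw'⟩ := lift_qis hP _ (qis_of_comp F hF _ h1) (BimodHom.id P)
  exact ⟨(ι.comp φ).comp w', β, ho_symm hw'⟩


/-! coordinates on a twisted bimodule -/

/-- coordinates -/
structure Coo (T : DGBimod A) (s : ℕ) (r : Fin s → ℤ) (e : Fin s → T.M) where
  he : ∀ j, e j ∈ T.gm (-(r j))
  c : Fin s → T.M →ₗ[k] A.R ⊗[k] A.R
  sum : ∀ m, m = ∑ j, biact T (c j m) (e j)
  cL : ∀ j (i : ℤ) (x : A.R), x ∈ A.gr i → ∀ m,
    c j (T.actL x m) = sgnz (i * (-(r j))) • tL x (c j m)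
  cR : ∀ j (x : A.R) m, c j (T.actR x m) = tR x (c j m)
  cb_same : ∀ j t, c j (biact T t (e j)) = t
  cb_ne : ∀ j i, i ≠ j → ∀ t, c j (biact T t (e i)) = 0

lemma exists_coo {T : DGBimod A} {s : ℕ} {r : Fin s → ℤ} {e : Fin s → T.M}
    (he : ∀ j, e j ∈ T.gm (-(r j)))
    (hb : Function.Bijective (fun v : Fin s → A.R ⊗[k] A.R => ∑ j, biact T (v j) (e j))) :
    Nonempty (Coo T s r e) := by
  let L : (Fin s → A.R ⊗[k] A.R) →ₗ[k] T.M :=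
    { toFun := fun v => ∑ j, biact T (v j) (e j)
      map_add' := by intro x y; simp [Finset.sum_add_distrib]
      map_smul' := by intro x y; simp [Finset.smul_sum] }
  let E := LinearEquiv.ofBijective L hb
  have hE : ∀ v, E v = ∑ j, biact T (v j) (e j) := fun v => rfl
  have h1 : ∀ m, m = ∑ j, biact T (E.symm m j) (e j) := by
    intro m; rw [← hE, E.apply_symm_apply]
  have h2 : ∀ (m : T.M) (v : Fin s → A.R ⊗[k] A.R), m = ∑ j, biact T (v j) (e j) → ∀ j, E.symm m j = v j := by
    intro m v h j
    rw [h, ← hE, E.symm_apply_apply]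
  refine ⟨⟨he, fun j => LinearMap.proj j ∘ₗ E.symm.toLinearMap, h1, ?_, ?_, ?_, ?_⟩⟩
  · intro j i x hx m
    refine h2 _ (fun j => sgnz (i * (-(r j))) • tL x (E.symm m j)) ?_ j
    conv_lhs => rw [h1 m, map_sum]
    refine Finset.sum_congr rfl fun j _ => ?_
    rw [biact_tL T hx (he j), map_zsmul, LinearMap.smul_apply]
  · intro j x m
    refine h2 _ (fun j => tR x (E.symm m j)) ?_ j
    conv_lhs => rw [h1 m, map_sum]
    refine Finset.sum_congr rfl fun j _ => ?_
    rw [biact_tR T x (he j)]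
  · intro j t
    have := h2 (biact T t (e j)) (Pi.single j t) (by
      rw [Finset.sum_eq_single j]
      · simp
      · intro i _ hi; simp [hi]
      · simp) j
    simpa using this
  · intro j i hij t
    have := h2 (biact T t (e i)) (Pi.single i t) (by
      rw [Finset.sum_eq_single i]
      · simp
      · intro i _ hi; simp [hi]
      · simp) j
    simpa [hij.symm] using this

lemma biact_one (N : DGBimod A) {l : ℤ} {w : N.M} (hw : w ∈ N.gm l) :
    biact N ((1 : A.R) ⊗ₜ[k] (1 : A.R)) w = w := by
  rw [biact_tmul N A.one_mem _ hw, N.actR_one, N.actL_one]; simp [sgnz]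

lemma biact_deg (N : DGBimod A) {i j l : ℤ} {a b : A.R} (ha : a ∈ A.gr i) (hb : b ∈ A.gr j)
    {w : N.M} (hw : w ∈ N.gm l) : biact N (a ⊗ₜ[k] b) w ∈ N.gm (i + (l + j)) := by
  rw [biact_tmul N ha _ hw]
  exact zsmul_mem (N.actL_deg _ _ _ _ ha (N.actR_deg _ _ _ _ hb hw)) _

/-- generator induction -/
lemma Coo.ind {T : DGBimod A} {s : ℕ} {r : Fin s → ℤ} {e : Fin s → T.M} (C : Coo T s r e)
    {p : T.M → Prop} (h0 : p 0) (hadd : ∀ a b, p a → p b → p (a + b))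
    (hom : ∀ i j l, ∀ a ∈ A.gr i, ∀ b ∈ A.gr j, p (biact T (a ⊗ₜ[k] b) (e l))) : ∀ m, p m := by
  intro m
  rw [C.sum m]
  refine Finset.sum_induction _ p hadd h0 ?_
  intro l _
  generalize C.c l m = t
  revert t
  refine tind ?_ ?_ ?_
  · simpa using h0
  · intro a b ha hb; simpa using hadd _ _ ha hb
  · intro i j a ha b hb; exact hom i j l a ha b hb

/-- `h` is a degree `-1` bimodule map -/
def IsHtpy {X Y : DGBimod A} (h : X.M →ₗ[k] Y.M) : Prop :=
  (∀ (j : ℤ), ∀ m ∈ X.gm j, h m ∈ Y.gm (j - 1)) ∧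
    (∀ (i : ℤ) (x : A.R), x ∈ A.gr i → ∀ m : X.M, h (X.actL x m) = sgnz i • Y.actL x (h m)) ∧
    (∀ (x : A.R) (m : X.M), h (X.actR x m) = Y.actR x (h m))

lemma Coo.ext {T N : DGBimod A} {s : ℕ} {r : Fin s → ℤ} {e : Fin s → T.M} (C : Coo T s r e)
    (j : Fin s) (w : N.M) (hw : w ∈ N.gm (-(r j) - 1)) :
    ∃ g : T.M →ₗ[k] N.M, IsHtpy g ∧ g (e j) = w ∧ ∀ i, i ≠ j → g (e i) = 0 := by
  let g : T.M →ₗ[k] N.M := (biact N).flip w ∘ₗ C.c j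
  have hg : ∀ m, g m = biact N (C.c j m) w := fun m => rfl
  refine ⟨g, ⟨?_, ?_, ?_⟩, ?_, ?_⟩
  · have key : ∀ m : T.M, ∀ l, g (pr T.gm l m) ∈ N.gm (l - 1) := by
      refine C.ind ?_ ?_ ?_
      · intro l; simp
      · intro a b ha hb l
        rw [map_add, map_add]; exact add_mem (ha l) (hb l)
      · intro p q l a ha b hb n
        have hd := biact_deg T ha hb (C.he l)
        by_cases hn : p + (-(r l) + q) = n
        · rw [hn] at hd
          rw [pr_same _ hd, hg]
          by_cases hl : l = j
          · subst hl
            rw [C.cb_same]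
            have := biact_deg N ha hb hw
            rwa [show p + (-(r l) - 1 + q) = n - 1 by rw [← hn]; ring] at this
          · rw [C.cb_ne j l hl]; simp
        · rw [pr_ne _ hd hn]; simp
    intro l m hm
    have := key m l
    rwa [pr_same _ hm] at this
  · intro i x hx m
    rw [hg, hg, C.cL j i x hx, biact_tL N hx hw, smul_smul, ← sgnz_add,
      show i + i * (-(r j) - 1) = i * (-(r j)) by ring, map_zsmul, LinearMap.smul_apply]
  · intro x m
    rw [hg, hg, C.cR, biact_tR N x hw]
  · rw [hg]
    conv_lhs => rw [← biact_one T (C.he j)]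
    rw [C.cb_same, biact_one N hw]
  · intro i hi
    rw [hg]
    conv_lhs => rw [← biact_one T (C.he i)]
    rw [C.cb_ne j i hi]; simp

lemma subset_biSpan (N : DGBimod A) (S : Set N.M) : S ⊆ biSpan N S := by
  intro m hm
  simp only [biSpan, SetLike.mem_coe, Submodule.mem_sInf]
  intro p hp; exact hp.1 hm

lemma biSpan_actL (N : DGBimod A) (S : Set N.M) (x : A.R) {m : N.M} (hm : m ∈ biSpan N S) :
    N.actL x m ∈ biSpan N S := by
  simp only [biSpan, Submodule.mem_sInf] at hm ⊢
  intro p hp; exact hp.2.1 x m (hm p hp)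

lemma biSpan_actR (N : DGBimod A) (S : Set N.M) (x : A.R) {m : N.M} (hm : m ∈ biSpan N S) :
    N.actR x m ∈ biSpan N S := by
  simp only [biSpan, Submodule.mem_sInf] at hm ⊢
  intro p hp; exact hp.2.2 x m (hm p hp)

/-- `biSpan` is contained in a submodule stable under homogeneous left and right actions. -/
lemma biSpan_le (N : DGBimod A) (S : Set N.M) (p : Submodule k N.M) (hS : S ⊆ p)
    (hL : ∀ (i : ℤ) (x : A.R), x ∈ A.gr i → ∀ m ∈ p, N.actL x m ∈ p)
    (hR : ∀ (x : A.R), ∀ m ∈ p, N.actR x m ∈ p) : biSpan N S ≤ p := by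
  refine sInf_le ⟨hS, ?_, fun x m hm => hR x m hm⟩
  intro x m hm
  revert x
  refine hind A.gr ?_ ?_ ?_
  · simp
  · intro a b ha hb; rw [map_add]; exact add_mem ha hb
  · intro i x hx; exact hL i x hx m hm

lemma biact_mem_biSpan (N : DGBimod A) (S : Set N.M) {w : N.M} {l : ℤ} (hw : w ∈ N.gm l)
    (h : w ∈ biSpan N S) (t) : biact N t w ∈ biSpan N S := by
  revert t
  refine tind ?_ ?_ ?_
  · simp
  · intro a b ha hb; rw [map_add]; exact add_mem ha hb
  · intro i j a ha b hb
    rw [biact_tmul N ha b hw]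
    exact zsmul_mem (biSpan_actL _ _ _ (biSpan_actR _ _ _ h)) _

lemma htpy_bilL {X Y : DGBimod A} (f : BimodHom X Y) (h : X.M →ₗ[k] Y.M) (hh : IsHtpy h)
    {i : ℤ} {x : A.R} (hx : x ∈ A.gr i) (m : X.M) :
    f.f (X.actL x m) - (Y.D (h (X.actL x m)) + h (X.D (X.actL x m))) =
      Y.actL x (f.f m - (Y.D (h m) + h (X.D m))) := by
  obtain ⟨h1, h2, h3⟩ := hh
  rw [f.actLc, h2 i x hx, leibL X hx, map_add, map_zsmul, map_zsmul, h2 i x hx, leibL Y hx,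
    h2 _ _ (A.d_deg i x hx), smul_add, sgnz_smul_smul, sgnz_smul_smul, sgnz_add, sgnz_one, map_sub,
    map_add]
  simp only [mul_neg, mul_one, neg_smul]
  abel

lemma htpy_bilR {X Y : DGBimod A} (f : BimodHom X Y) (h : X.M →ₗ[k] Y.M) (hh : IsHtpy h)
    (x : A.R) (m : X.M) :
    f.f (X.actR x m) - (Y.D (h (X.actR x m)) + h (X.D (X.actR x m))) =
      Y.actR x (f.f m - (Y.D (h m) + h (X.D m))) := by
  obtain ⟨h1, h2, h3⟩ := hh
  revert m
  refine hind X.gm ?_ ?_ ?_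
  · simp
  · intro a b ha hb
    have := congrArg₂ (· + ·) ha hb
    simp only [map_add, map_sub] at this ⊢
    refine Eq.trans ?_ (this.trans ?_) <;> abel
  · intro j m hm
    rw [f.actRc, h3, leibR X hm, leibR Y (h1 j m hm), map_add, map_zsmul, h3, h3, map_sub, map_add,
      show sgnz j = - sgnz (j - 1) by
        rw [show j = (j - 1) + 1 by ring, sgnz_add, sgnz_one]; simp]
    simp only [neg_smul]
    abel

/-- vanishing on the sub-bimodule generated -/
lemma htpy_vanish {X Y : DGBimod A} (f : BimodHom X Y) (h : X.M →ₗ[k] Y.M) (hh : IsHtpy h)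
    (S : Set X.M) (hS : ∀ m ∈ S, f.f m - (Y.D (h m) + h (X.D m)) = 0) :
    ∀ m ∈ biSpan X S, f.f m - (Y.D (h m) + h (X.D m)) = 0 := by
  let q : X.M →ₗ[k] Y.M := f.f - (Y.D ∘ₗ h + h ∘ₗ X.D)
  have : biSpan X S ≤ LinearMap.ker q := by
    refine biSpan_le X S _ (fun m hm => hS m hm) ?_ ?_
    · intro i x hx m hm
      change f.f (X.actL x m) - (Y.D (h (X.actL x m)) + h (X.D (X.actL x m))) = 0
      rw [htpy_bilL f h hh hx]
      have : f.f m - (Y.D (h m) + h (X.D m)) = 0 := hm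
      rw [this, map_zero]
    · intro x m hm
      change f.f (X.actR x m) - (Y.D (h (X.actR x m)) + h (X.D (X.actR x m))) = 0
      rw [htpy_bilR f h hh x]
      have : f.f m - (Y.D (h m) + h (X.D m)) = 0 := hm
      rw [this, map_zero]
  exact fun m hm => this hm

lemma twisted_hoproj {T : DGBimod A} (hT : IsTwistedB T) : IsHoProjB T := by
  obtain ⟨s, r, e, he, hD, hb⟩ := hT
  obtain ⟨C⟩ := exists_coo he hb
  intro N hN f
  have main : ∀ n : ℕ, n ≤ s → ∃ h : T.M →ₗ[k] N.M, IsHtpy h ∧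
      ∀ i : Fin s, i.val < n → f.f (e i) - (N.D (h (e i)) + h (T.D (e i))) = 0 := by
    intro n
    induction n with
    | zero =>
      intro _
      exact ⟨0, ⟨fun j m _ => zero_mem _, fun _ _ _ _ => by simp, fun _ _ => by simp⟩,
        fun i hi => absurd hi (Nat.not_lt_zero _)⟩
    | succ n ih =>
      intro hn
      obtain ⟨h, hh, hv⟩ := ih (by omega)
      let j : Fin s := ⟨n, by omega⟩
      have hDj : f.f (T.D (e j)) - (N.D (h (T.D (e j))) + h (T.D (T.D (e j)))) = 0 := by
        refine htpy_vanish f h hh _ ?_ _ (hD j)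
        rintro _ ⟨i, hi, rfl⟩
        exact hv i hi
      rw [T.D_sq, map_zero, add_zero, sub_eq_zero] at hDj
      have hz : f.f (e j) - (N.D (h (e j)) + h (T.D (e j))) ∈ Zg N.gm N.D (-(r j) - 1 + 1) := by
        rw [sub_add_cancel]
        refine ⟨?_, ?_⟩
        · refine sub_mem (f.deg _ _ (he j)) (add_mem ?_ ?_)
          · have := N.D_deg _ _ (hh.1 _ _ (he j))
            rwa [sub_add_cancel] at this
          · have := hh.1 _ _ (T.D_deg _ _ (he j))
            rwa [add_sub_cancel_right] at this
        · rw [SetLike.mem_coe, LinearMap.mem_ker, map_sub, map_add, N.D_sq, zero_add, ← f.comm, hDj,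
            sub_self]
      have hz' := hN _ hz
      obtain ⟨w, hw, hw'⟩ := exists_pre_deg N.gm N.D N.D_deg hz'.1 hz'.2
      obtain ⟨g, hg, hg1, hg2⟩ := C.ext j w hw
      have hgs : ∀ i : Fin s, i ≤ j → g (T.D (e i)) = 0 := by
        intro i hi
        have : biSpan T (e '' {l | l < i}) ≤ LinearMap.ker g := by
          refine biSpan_le T _ _ ?_ ?_ ?_
          · rintro _ ⟨l, hl, rfl⟩
            exact hg2 l (ne_of_lt (lt_of_lt_of_le hl hi))
          · intro i x hx m hm
            rw [LinearMap.mem_ker] at hm ⊢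
            rw [hg.2.1 i x hx, hm]; simp
          · intro x m hm
            rw [LinearMap.mem_ker] at hm ⊢
            rw [hg.2.2, hm]; simp
        exact this (hD i)
      refine ⟨h + g, ⟨?_, ?_, ?_⟩, ?_⟩
      · intro l m hm; exact add_mem (hh.1 l m hm) (hg.1 l m hm)
      · intro i x hx m
        simp [hh.2.1 i x hx, hg.2.1 i x hx]
      · intro x m; simp [hh.2.2, hg.2.2]
      · intro i hi
        simp only [LinearMap.add_apply, map_add]
        rcases Nat.lt_succ_iff_lt_or_eq.1 hi with hi | hi
        · have h1 := hv i hi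
          rw [hgs i (le_of_lt hi), hg2 i (ne_of_lt hi)]
          simpa using h1
        · have : i = j := Fin.ext hi
          subst this
          rw [hgs _ le_rfl, hg1, hw']
          abel
  obtain ⟨h, hh, hv⟩ := main s le_rfl
  refine ⟨h, hh.1, hh.2.1, hh.2.2, ?_⟩
  intro m
  have := htpy_vanish f h hh (Set.range e) (by rintro _ ⟨i, rfl⟩; exact hv i i.2) m (by
    rw [C.sum m]
    refine sum_mem fun j _ => biact_mem_biSpan T _ (he j) (subset_biSpan T _ (Set.mem_range_self j)) _)
  rw [sub_eq_zero] at this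
  rw [← this]
  simp [BimodHom.zero]


lemma exists_lift_fd {X Y : Type} [AddCommGroup X] [Module k X] [AddCommGroup Y] [Module k Y]
    (L : X →ₗ[k] Y) (S : Submodule k X) (W : Submodule k Y) [FiniteDimensional k W] :
    ∃ V : Submodule k X, FiniteDimensional k V ∧ V ≤ S ∧ ∀ f ∈ S, L f ∈ W → ∃ v ∈ V, L v = L f := by
  obtain ⟨g, hg⟩ := (L.domRestrict S).rangeRestrict.exists_rightInverse_of_surjective
    (LinearMap.range_eq_top.2 (LinearMap.surjective_rangeRestrict _))
  let R := LinearMap.range (L.domRestrict S)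
  have hfd : FiniteDimensional k (W.comap R.subtype) := by
    refine Module.Finite.of_injective
      ((R.subtype.comp (W.comap R.subtype).subtype).codRestrict W (fun x => x.2)) ?_
    intro x y hxy
    have := congrArg Subtype.val hxy
    exact Subtype.ext (Subtype.ext this)
  refine ⟨(W.comap R.subtype).map (S.subtype ∘ₗ g), inferInstance, ?_, ?_⟩
  · rintro _ ⟨y, _, rfl⟩; exact (g y).2
  · intro f hf hW
    let y : R := ⟨L f, ⟨⟨f, hf⟩, rfl⟩⟩
    refine ⟨_, ⟨y, hW, rfl⟩, ?_⟩
    have := congrArg Subtype.val (LinearMap.congr_fun hg y)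
    exact this

lemma compact_fd (hc : IsCompactAlg A) :
    ∃ V : Submodule k A.R, FiniteDimensional k V ∧ ∀ a, A.d a = 0 → a ∈ V ⊔ LinearMap.range A.d := by
  obtain ⟨h1, h2⟩ := hc
  have h3 : ∀ n, ∃ V : Submodule k A.R, FiniteDimensional k V ∧
      ∀ z ∈ Zg A.gr A.d n, z ∈ V ⊔ LinearMap.range A.d := by
    intro n
    let B := Submodule.comap (Zg A.gr A.d n).subtype (Bg A.gr A.d n)
    have : FiniteDimensional k (↥(Zg A.gr A.d n) ⧸ B) := h1 n
    obtain ⟨V, hV, -, hV'⟩ := exists_lift_fd B.mkQ ⊤ ⊤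
    refine ⟨V.map (Zg A.gr A.d n).subtype, inferInstance, ?_⟩
    intro z hz
    obtain ⟨v, hv, hvz⟩ := hV' ⟨z, hz⟩ trivial trivial
    rw [← sub_eq_zero, ← map_sub, Submodule.mkQ_apply, Submodule.Quotient.mk_eq_zero] at hvz
    have hvz' : (v : A.R) - z ∈ Bg A.gr A.d n := hvz
    have h4 : z = (v : A.R) + -((v : A.R) - z) := by abel
    rw [h4]
    exact Submodule.add_mem_sup ⟨v, hv, rfl⟩ (neg_mem hvz'.2)
  choose V hV hV' using h3
  refine ⟨h2.toFinset.sup V, Submodule.finiteDimensional_finset_sup _ _, ?_⟩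
  intro a ha
  classical
  rw [← DirectSum.sum_support_decompose A.gr a]
  refine sum_mem fun n _ => ?_
  have hz : (DirectSum.decompose A.gr a n : A.R) ∈ Zg A.gr A.d n := by
    refine ⟨SetLike.coe_mem _, ?_⟩
    have := pr_shift A.gr A.gr A.d 1 A.d_deg n a
    rw [ha, map_zero] at this
    exact this.symm
  by_cases hn : Subsingleton (Hg A.gr A.d n)
  · refine Submodule.mem_sup_right ?_
    have hs : Subsingleton (↥(Zg A.gr A.d n) ⧸
      Submodule.comap (Zg A.gr A.d n).subtype (Bg A.gr A.d n)) := hn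
    have h5 := (Submodule.Quotient.mk_eq_zero
      (Submodule.comap (Zg A.gr A.d n).subtype (Bg A.gr A.d n)) (x := ⟨_, hz⟩)).1
      (Subsingleton.elim _ _)
    exact h5.2
  · exact sup_le_sup_right (Finset.le_sup (f := V) (h2.mem_toFinset.2 hn)) _ (hV' n _ hz)

/-- even part -/
def evp (A : DGAlgebra k) : A.R →ₗ[k] A.R := gop A.gr (fun j => if Even j then 1 else 0)
/-- odd part -/
def odp (A : DGAlgebra k) : A.R →ₗ[k] A.R := gop A.gr (fun j => if Even j then 0 else 1)

/-- the signed opposite multiplication -/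
def tau (A : DGAlgebra k) : A.R ⊗[k] A.R →ₗ[k] A.R :=
  TensorProduct.lift (LinearMap.mk₂ k (fun a b => b * evp A a + sg A b * odp A a)
    (by intro a a' b; simp only [map_add, mul_add]; abel)
    (by intro c a b; simp)
    (by intro a b b'; simp only [map_add, add_mul]; abel)
    (by intro c a b; simp))

lemma tau_tmul {i j : ℤ} {a b : A.R} (ha : a ∈ A.gr i) (hb : b ∈ A.gr j) :
    tau A (a ⊗ₜ b) = sgnz (i * j) • (b * a) := by
  simp only [tau, TensorProduct.lift.tmul, LinearMap.mk₂_apply, evp, odp]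
  rw [gop_apply _ _ ha, gop_apply _ _ ha, sg_apply hb]
  by_cases hi : Even i
  · simp [hi, sgnz]
  · simp [hi, sgnz, Int.even_mul]

lemma tau_one (b : A.R) : tau A (1 ⊗ₜ b) = b := by
  simp only [tau, TensorProduct.lift.tmul, LinearMap.mk₂_apply, evp, odp]
  rw [gop_apply _ _ A.one_mem, gop_apply _ _ A.one_mem]
  simp

lemma sgnz_two (a c : ℤ) : sgnz (a + 2 * c) = sgnz a := by
  simp [sgnz, Int.even_add]

lemma comm_mem (P : DGBimod A) {i j : ℤ} {x : A.R} {m : P.M} (hx : x ∈ A.gr i) (hm : m ∈ P.gm j) :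
    P.actL x m - sgnz (i * j) • P.actR x m ∈ commSub P :=
  Submodule.subset_span ⟨i, j, x, m, hx, hm, rfl⟩

lemma Coo.tau_comm {T : DGBimod A} {s : ℕ} {r : Fin s → ℤ} {e : Fin s → T.M} (C : Coo T s r e)
    (j : Fin s) : ∀ z ∈ commSub T, tau A (C.c j z) = 0 := by
  have key : ∀ (i : ℤ) (x : A.R), x ∈ A.gr i → ∀ m, tau A (C.c j (T.actL x m)) =
      tau A (C.c j (T.actR x (gop T.gm (fun l => sgnk k (i * l)) m))) := by
    intro i x hx
    refine C.ind ?_ ?_ ?_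
    · simp
    · intro a b ha hb; simp only [map_add, ha, hb]
    · intro p q l a ha b hb
      rw [gop_apply _ _ (biact_deg T ha hb (C.he l)), sgnk_smul, C.cL j i x hx, C.cR]
      by_cases hl : l = j
      · subst hl
        rw [map_zsmul, map_zsmul, map_zsmul, map_zsmul, C.cb_same]
        simp only [tL, tR, TensorProduct.map_tmul, LinearMap.mulLeft_apply,
          LinearMap.mulRight_apply, LinearMap.id_apply]
        rw [tau_tmul (A.mul_mem hx ha) hb, tau_tmul ha (A.mul_mem hb hx), smul_smul, smul_smul,
          ← sgnz_add, ← sgnz_add, mul_assoc]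
        congr 1
        rw [← sgnz_two _ (i * p)]
        congr 1; ring
      · rw [map_zsmul (C.c j), C.cb_ne j l hl]; simp
  intro z hz
  have : commSub T ≤ LinearMap.ker (tau A ∘ₗ C.c j) := by
    refine Submodule.span_le.2 ?_
    rintro _ ⟨i, l, x, m, hx, hm, rfl⟩
    have := key i x hx m
    rw [gop_apply _ _ hm, sgnk_smul, map_zsmul] at this
    rw [SetLike.mem_coe, LinearMap.mem_ker, map_sub, LinearMap.comp_apply, this,
      LinearMap.comp_apply, sub_self]
  exact this hz

lemma tau_mod (T : DGBimod A) {l : ℤ} {w : T.M} (hw : w ∈ T.gm l) (t) :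
    biact T t w - T.actR (tau A t) w ∈ commSub T := by
  revert t
  refine tind ?_ ?_ ?_
  · simp
  · intro a b ha hb
    have := add_mem ha hb
    simp only [map_add, LinearMap.add_apply]
    convert this using 1; abel
  · intro p q a ha b hb
    rw [biact_tmul T ha b hw, tau_tmul ha hb]
    have h1 := zsmul_mem (comm_mem T ha (T.actR_deg _ _ _ _ hb hw)) (sgnz (p * l))
    rw [smul_sub, smul_smul, ← sgnz_add, ← T.actR_mul,
      show p * l + p * (l + q) = p * q + 2 * (p * l) by ring, sgnz_two] at h1
    rwa [map_zsmul, LinearMap.smul_apply]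

lemma D_comm (P : DGBimod A) {z : P.M} (hz : z ∈ commSub P) : P.D z ∈ commSub P := by
  have : commSub P ≤ (commSub P).comap P.D := by
    refine Submodule.span_le.2 ?_
    rintro _ ⟨i, j, x, m, hx, hm, rfl⟩
    rw [SetLike.mem_coe, Submodule.mem_comap, map_sub, map_zsmul, leibL P hx, leibR P hm]
    have h1 := comm_mem P (A.d_deg _ _ hx) hm
    have h2 := zsmul_mem (comm_mem P hx (P.D_deg _ _ hm)) (sgnz i)
    convert add_mem h1 h2 using 1
    rw [smul_sub, smul_smul, ← sgnz_add, smul_add, smul_smul, ← sgnz_add,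
      show i + i * (j + 1) = i * j + 2 * i by ring, sgnz_two,
      show (i + 1) * j = i * j + j by ring]
    abel
  exact this hz

/-- total finiteness of the homology of `P/[A,P]` -/
def SmallHH (P : DGBimod A) : Prop := ∃ V : Submodule k P.M, FiniteDimensional k V ∧
  ∀ z, P.D z ∈ commSub P → z ∈ V ⊔ (commSub P ⊔ LinearMap.range P.D)

lemma twisted_small (hc : IsCompactAlg A) {T : DGBimod A} (hT : IsTwistedB T) : SmallHH T := by
  obtain ⟨s, r, e, he, hD, hb⟩ := hT
  obtain ⟨C⟩ := exists_coo he hb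
  obtain ⟨V₀, hV₀, hV₀'⟩ := compact_fd hc
  let U : ℕ → Submodule k T.M := fun n => biSpan T (e '' {i | i.val < n})
  have hU0 : U 0 ≤ ⊥ := by
    refine biSpan_le T _ _ ?_ ?_ ?_
    · rintro _ ⟨i, hi, rfl⟩; exact absurd hi (Nat.not_lt_zero _)
    · intro i x hx m hm; rw [Submodule.mem_bot] at hm ⊢; rw [hm, map_zero]
    · intro x m hm; rw [Submodule.mem_bot] at hm ⊢; rw [hm, map_zero]
  have hUm : ∀ {n n' : ℕ}, n ≤ n' → U n ≤ U n' := by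
    intro n n' h
    refine biSpan_le T _ _ ?_ (fun i x _ m hm => biSpan_actL _ _ _ hm)
      (fun x m hm => biSpan_actR _ _ _ hm)
    rintro _ ⟨i, hi, rfl⟩
    exact subset_biSpan T _ ⟨i, lt_of_lt_of_le hi h, rfl⟩
  have hUs : ∀ n (hn : n < s), U (n + 1) ≤ U n ⊔ LinearMap.range ((biact T).flip (e ⟨n, hn⟩)) := by
    intro n hn
    refine biSpan_le T _ _ ?_ ?_ ?_
    · rintro _ ⟨i, hi, rfl⟩
      rcases Nat.lt_succ_iff_lt_or_eq.1 hi with hi | hi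
      · exact Submodule.mem_sup_left (subset_biSpan T _ ⟨i, hi, rfl⟩)
      · have : i = ⟨n, hn⟩ := Fin.ext hi
        subst this
        exact Submodule.mem_sup_right ⟨_, biact_one T (he _)⟩
    · intro i x hx m hm
      obtain ⟨u, hu, _, ⟨t, rfl⟩, rfl⟩ := Submodule.mem_sup.1 hm
      rw [map_add]
      refine Submodule.add_mem_sup (biSpan_actL _ _ _ hu) ?_
      rw [LinearMap.flip_apply, biact_tL T hx (he _)]
      exact zsmul_mem (LinearMap.mem_range_self _ _) _
    · intro x m hm
      obtain ⟨u, hu, _, ⟨t, rfl⟩, rfl⟩ := Submodule.mem_sup.1 hm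
      rw [map_add]
      refine Submodule.add_mem_sup (biSpan_actR _ _ _ hu) ?_
      rw [LinearMap.flip_apply, biact_tR T x (he _)]
      exact LinearMap.mem_range_self _ _
  have hDe : ∀ n (hn : n < s), T.D (e ⟨n, hn⟩) ∈ U n := fun n hn => hD ⟨n, hn⟩
  have hDU : ∀ n, n ≤ s → ∀ u ∈ U n, T.D u ∈ U n := by
    intro n
    induction n with
    | zero =>
      intro _ u hu
      have : u = 0 := (Submodule.mem_bot k).1 (hU0 hu)
      rw [this, map_zero]; exact zero_mem _
    | succ n ih =>
      intro hn u hu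
      obtain ⟨u', hu', _, ⟨t, rfl⟩, rfl⟩ := Submodule.mem_sup.1 (hUs n hn hu)
      rw [map_add]
      refine add_mem (hUm (Nat.le_succ n) (ih (by omega) u' hu')) ?_
      rw [LinearMap.flip_apply]
      clear hu
      have hen : e ⟨n, hn⟩ ∈ U (n + 1) := subset_biSpan T _ ⟨_, Nat.lt_succ_self n, rfl⟩
      revert t
      refine tind ?_ ?_ ?_
      · simp
      · intro a b ha hb; simp only [map_add, LinearMap.add_apply]; exact add_mem ha hb
      · intro p q a ha b hb
        rw [biact_tmul T ha b (he _), map_zsmul, leibL T ha, leibR T (he _)]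
        refine zsmul_mem (add_mem ?_ (zsmul_mem ?_ _)) _
        · exact biSpan_actL _ _ _ (biSpan_actR _ _ _ hen)
        · refine biSpan_actL _ _ _ (add_mem ?_ (zsmul_mem ?_ _))
          · exact biSpan_actR _ _ _ (hUm (Nat.le_succ n) (hDe n hn))
          · exact biSpan_actR _ _ _ hen
  have hcU : ∀ n (hn : n < s), U n ≤ LinearMap.ker (C.c ⟨n, hn⟩) := by
    intro n hn
    refine biSpan_le T _ _ ?_ ?_ ?_
    · rintro _ ⟨i, hi, rfl⟩
      rw [SetLike.mem_coe, LinearMap.mem_ker]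
      rw [← biact_one T (he i)]
      have hi2 : i.val < n := hi
      refine C.cb_ne _ _ (fun h => ?_) _
      have h3 := congrArg Fin.val h
      simp only at h3
      omega
    · intro i x hx m hm
      rw [LinearMap.mem_ker] at hm ⊢
      rw [C.cL _ i x hx, hm, map_zero, smul_zero]
    · intro x m hm
      rw [LinearMap.mem_ker] at hm ⊢
      rw [C.cR, hm, map_zero]
  have main : ∀ n, n ≤ s → ∃ V : Submodule k T.M, FiniteDimensional k V ∧
      ∀ z ∈ commSub T ⊔ U n, T.D z ∈ commSub T → z ∈ V ⊔ (commSub T ⊔ LinearMap.range T.D) := by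
    intro n
    induction n with
    | zero =>
      intro _
      refine ⟨⊥, inferInstance, ?_⟩
      intro z hz _
      have : z ∈ commSub T := (sup_le le_rfl (hU0.trans bot_le)) hz
      exact Submodule.mem_sup_right (Submodule.mem_sup_left this)
    | succ n ih =>
      intro hn
      obtain ⟨V₁, hV₁, hV₁'⟩ := ih (by omega)
      set E := e ⟨n, hn⟩ with hE
      have heE : E ∈ T.gm (-(r ⟨n, hn⟩)) := he _
      let L : T.M →ₗ[k] T.M ⧸ commSub T := (commSub T).mkQ ∘ₗ T.D
      let V₂ : Submodule k T.M := V₀.map (T.actR.flip E)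
      have hV₂ : FiniteDimensional k V₂ := inferInstance
      have hW : FiniteDimensional k (V₂.map L) := inferInstance
      obtain ⟨V₃, hV₃, hV₃S, hV₃'⟩ := exists_lift_fd L (commSub T ⊔ U n) (V₂.map L)
      refine ⟨V₁ ⊔ (V₂ ⊔ V₃), inferInstance, ?_⟩
      intro z hz hDz
      have hz1 : ∃ a : A.R, z - T.actR a E ∈ commSub T ⊔ U n := by
        obtain ⟨κ, hκ, u, hu, rfl⟩ := Submodule.mem_sup.1 hz
        obtain ⟨u', hu', _, ⟨t, rfl⟩, rfl⟩ := Submodule.mem_sup.1 (hUs n hn hu)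
        refine ⟨tau A t, ?_⟩
        rw [LinearMap.flip_apply]
        have h1 := tau_mod T heE t
        have h2 : κ + (u' + biact T t E) - T.actR (tau A t) E =
          (κ + (biact T t E - T.actR (tau A t) E)) + u' := by abel
        rw [h2]
        exact Submodule.add_mem_sup (add_mem hκ h1) hu'
      obtain ⟨a, ha⟩ := hz1
      have hDF : ∀ f ∈ commSub T ⊔ U n, T.D f ∈ commSub T ⊔ U n := by
        intro f hf
        obtain ⟨κ, hκ, u, hu, rfl⟩ := Submodule.mem_sup.1 hf
        rw [map_add]
        exact Submodule.add_mem_sup (D_comm T hκ) (hDU n (by omega) u hu)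
      have hleib : ∀ b, T.D (T.actR b E) = T.actR b (T.D E) +
          sgnz (-(r ⟨n, hn⟩)) • T.actR (A.d b) E := fun b => leibR T heE b
      have hEU : ∀ b, T.actR b (T.D E) ∈ commSub T ⊔ U n := fun b =>
        Submodule.mem_sup_right (biSpan_actR _ _ _ (hDe n hn))
      have hda : A.d a = 0 := by
        have h1 : T.D (T.actR a E) ∈ commSub T ⊔ U n := by
          have h0 : T.D z ∈ commSub T ⊔ U n := Submodule.mem_sup_left hDz
          have h2 := sub_mem h0 (hDF _ ha)
          rw [map_sub, sub_sub_cancel] at h2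
          exact h2
        rw [hleib] at h1
        have h3 := zsmul_mem (sub_mem h1 (hEU a)) (sgnz (-(r ⟨n, hn⟩)))
        rw [add_sub_cancel_left, sgnz_smul_smul] at h3
        have h4 : T.actR (A.d a) E = biact T (1 ⊗ₜ A.d a) E := by
          rw [biact_tmul T A.one_mem _ heE, T.actL_one]; simp [sgnz]
        have h5 : commSub T ⊔ U n ≤ LinearMap.ker (tau A ∘ₗ C.c ⟨n, hn⟩) := by
          refine sup_le (fun z hz => C.tau_comm _ z hz) ?_
          intro u hu
          have := hcU n hn hu
          rw [LinearMap.mem_ker] at this ⊢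
          rw [LinearMap.comp_apply, this, map_zero]
        have h6 := h5 h3
        rw [LinearMap.mem_ker, LinearMap.comp_apply, h4, C.cb_same, tau_one] at h6
        exact h6
      obtain ⟨v, hv, _, ⟨b, rfl⟩, rfl⟩ := Submodule.mem_sup.1 (hV₀' a hda)
      set σ := sgnz (-(r ⟨n, hn⟩)) with hσ
      have hf' : z - T.actR v E - σ • T.D (T.actR b E) ∈ commSub T ⊔ U n := by
        rw [hleib, smul_add, sgnz_smul_smul]
        have h1 := sub_mem ha (zsmul_mem (hEU b) σ)
        convert h1 using 1
        rw [map_add, LinearMap.add_apply]; abel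
      have hvV : T.actR v E ∈ V₂ := ⟨v, hv, rfl⟩
      have hLf : L (z - T.actR v E - σ • T.D (T.actR b E)) = - L (T.actR v E) := by
        have h1 : L z = 0 := (Submodule.Quotient.mk_eq_zero _).2 hDz
        have h2 : ∀ y, L (T.D y) = 0 := by
          intro y
          change (commSub T).mkQ (T.D (T.D y)) = 0
          rw [T.D_sq, map_zero]
        rw [map_sub, map_sub, map_zsmul, h1, h2]; simp
      obtain ⟨v', hv', hLv'⟩ := hV₃' _ hf' (by rw [hLf]; exact neg_mem ⟨_, hvV, rfl⟩)
      have hfin := hV₁' (z - T.actR v E - σ • T.D (T.actR b E) - v')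
        (sub_mem hf' (hV₃S hv')) (by
          rw [← Submodule.Quotient.mk_eq_zero]
          change L _ = 0
          rw [map_sub, hLv', sub_self])
      obtain ⟨v₁, hv₁, q, hq, hvq⟩ := Submodule.mem_sup.1 hfin
      have h7 : z = (v₁ + (T.actR v E + v')) + (q + σ • T.D (T.actR b E)) := by
        have : z = (z - T.actR v E - σ • T.D (T.actR b E) - v') +
          (T.actR v E + σ • T.D (T.actR b E) + v') := by abel
        rw [this, ← hvq]; abel
      rw [h7]
      refine Submodule.add_mem_sup (Submodule.add_mem_sup hv₁ (Submodule.add_mem_sup hvV hv'))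
        (add_mem hq (zsmul_mem (Submodule.mem_sup_right (LinearMap.mem_range_self _ _)) _))
  obtain ⟨V, hV, hV'⟩ := main s le_rfl
  refine ⟨V, hV, fun z hz => hV' z (Submodule.mem_sup_right ?_) hz⟩
  rw [C.sum z]
  exact sum_mem fun j _ => biact_mem_biSpan T (e '' {i | i.val < s}) (he j)
    (subset_biSpan T _ ⟨j, j.2, rfl⟩) _

lemma hom_comm {P T : DGBimod A} (f : BimodHom P T) {z : P.M} (hz : z ∈ commSub P) :
    f.f z ∈ commSub T := by
  have : commSub P ≤ (commSub T).comap f.f := by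
    refine Submodule.span_le.2 ?_
    rintro _ ⟨i, j, x, m, hx, hm, rfl⟩
    rw [SetLike.mem_coe, Submodule.mem_comap, map_sub, map_zsmul, f.actLc, f.actRc]
    exact comm_mem T hx (f.deg _ _ hm)
  exact this hz

lemma htpy_comm {P T : DGBimod A} (h : P.M →ₗ[k] T.M) (hh : IsHtpy h) {z : P.M}
    (hz : z ∈ commSub P) : h z ∈ commSub T := by
  have : commSub P ≤ (commSub T).comap h := by
    refine Submodule.span_le.2 ?_
    rintro _ ⟨i, j, x, m, hx, hm, rfl⟩
    rw [SetLike.mem_coe, Submodule.mem_comap, map_sub, map_zsmul, hh.2.1 i x hx, hh.2.2]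
    have h1 := zsmul_mem (comm_mem T hx (hh.1 _ _ hm)) (sgnz i)
    rwa [smul_sub, smul_smul, ← sgnz_add, show i + i * (j - 1) = i * j by ring] at h1
  exact this hz

lemma small_retract {P T : DGBimod A} (hPT : IsHoSummandB P T) (hT : SmallHH T) : SmallHH P := by
  obtain ⟨α, β, h, h1, h2, h3, h4⟩ := hPT
  obtain ⟨V, hV, hV'⟩ := hT
  refine ⟨V.map β.f, inferInstance, ?_⟩
  intro z hz
  have hα : T.D (α.f z) ∈ commSub T := by rw [← α.comm]; exact hom_comm α hz
  obtain ⟨v, hv, q, hq, hvq⟩ := Submodule.mem_sup.1 (hV' _ hα)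
  obtain ⟨κ, hκ, _, ⟨y, rfl⟩, rfl⟩ := Submodule.mem_sup.1 hq
  have h5 : β.f (α.f z) - z = P.D (h z) + h (P.D z) := h4 z
  have h6 : z = β.f v + ((β.f κ - h (P.D z)) + P.D (β.f y - h z)) := by
    rw [map_sub, ← β.comm]
    have h7 : z = β.f (α.f z) - (P.D (h z) + h (P.D z)) := by rw [← h5]; abel
    conv_lhs => rw [h7, ← hvq]
    simp only [map_add]; abel
  rw [h6]
  exact Submodule.add_mem_sup ⟨v, hv, rfl⟩ (Submodule.add_mem_sup
    (sub_mem (hom_comm β hκ) (htpy_comm h ⟨h1, h2, h3⟩ hz)) (LinearMap.mem_range_self _ _))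

lemma fin_quot {X W : Type} [AddCommGroup X] [Module k X] [AddCommGroup W] [Module k W]
    [FiniteDimensional k W] (φ : X →ₗ[k] W) (p : Submodule k X) (h : LinearMap.ker φ ≤ p) :
    FiniteDimensional k (X ⧸ p) := by
  have : Module.Finite k (X ⧸ LinearMap.ker φ) := Module.Finite.equiv φ.quotKerEquivRange.symm
  exact Module.Finite.of_surjective (Submodule.factor h) (Submodule.factor_surjective h)

lemma fd_support {M : Type} [AddCommGroup M] [Module k M] (gm : ℤ → Submodule k M)
    [DirectSum.Decomposition gm] (V : Submodule k M) [hV : FiniteDimensional k V] :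
    ∃ S : Set ℤ, S.Finite ∧ ∀ v ∈ V, ∀ n, n ∉ S → pr gm n v = 0 := by
  have h1 : ∀ v, {n | pr gm n v ≠ 0}.Finite := by
    refine hind gm ?_ ?_ ?_
    · simp
    · intro a b ha hb
      refine (ha.union hb).subset ?_
      intro n hn
      by_contra hcon
      simp only [Set.mem_union, Set.mem_ofPred_eq, not_or, not_not] at hcon hn
      exact hn (by rw [map_add, hcon.1, hcon.2, add_zero])
    · intro i m hm
      refine (Set.finite_singleton i).subset ?_
      intro n hn
      by_contra hcon
      exact hn (pr_ne gm hm (fun h => hcon h.symm))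
  obtain ⟨t, ht⟩ := (Module.Finite.iff_fg (N := V)).1 hV
  refine ⟨⋃ v ∈ t, {n | pr gm n v ≠ 0}, t.finite_toSet.biUnion (fun v _ => h1 v), ?_⟩
  intro v hv n hn
  have : V ≤ LinearMap.ker (pr gm n) := by
    rw [← ht, Submodule.span_le]
    intro w hw
    by_contra hcon
    exact hn (Set.mem_biUnion hw hcon)
  exact this hv

lemma small_final {P : DGBimod A} (hP : SmallHH P) :
    (∀ n : ℤ, FiniteDimensional k (HHspace P n)) ∧
      {n : ℤ | ¬ Subsingleton (HHspace P n)}.Finite := by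
  obtain ⟨V, hV, hV'⟩ := hP
  let I := commSub P ⊔ LinearMap.range P.D
  constructor
  · intro n
    let φ : ↥(HHZ P n) →ₗ[k] V.map I.mkQ :=
      (I.mkQ ∘ₗ (HHZ P n).subtype).codRestrict _ (by
        rintro ⟨z, hz⟩
        obtain ⟨v, hv, q, hq, rfl⟩ := Submodule.mem_sup.1 (hV' z hz.2)
        refine ⟨v, hv, ?_⟩
        change I.mkQ v = I.mkQ (v + q)
        have h1 : I.mkQ q = 0 := (Submodule.Quotient.mk_eq_zero _).2 hq
        rw [map_add, h1, add_zero])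
    refine fin_quot φ _ ?_
    rintro ⟨z, hz⟩ h0
    have h1 : I.mkQ z = 0 := congrArg Subtype.val h0
    have h2 : z ∈ I := (Submodule.Quotient.mk_eq_zero _).1 h1
    exact ⟨⟨hz.1, h2⟩, hz⟩
  · obtain ⟨S, hS, hSV⟩ := fd_support P.gm V
    refine hS.subset ?_
    intro n hn
    by_contra hnS
    refine hn ?_
    have hI : I ≤ I.comap (pr P.gm n) := by
      refine sup_le (Submodule.span_le.2 ?_) ?_
      · rintro _ ⟨i, j, x, m, hx, hm, rfl⟩
        have hd : P.actL x m - sgnz (i * j) • P.actR x m ∈ P.gm (i + j) := by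
          refine sub_mem (P.actL_deg _ _ _ _ hx hm) (zsmul_mem ?_ _)
          rw [add_comm]; exact P.actR_deg _ _ _ _ hx hm
        rw [SetLike.mem_coe, Submodule.mem_comap]
        by_cases h : i + j = n
        · rw [h] at hd
          rw [pr_same _ hd]; exact Submodule.mem_sup_left (comm_mem P hx hm)
        · rw [pr_ne _ hd h]; exact zero_mem _
      · rintro _ ⟨y, rfl⟩
        have := pr_shift P.gm P.gm P.D 1 P.D_deg (n - 1) y
        rw [sub_add_cancel] at this
        rw [Submodule.mem_comap, this]
        exact Submodule.mem_sup_right (LinearMap.mem_range_self _ _)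
    have key : ∀ z ∈ HHZ P n, z ∈ I := by
      intro z hz
      obtain ⟨v, hv, q, hq, hvq⟩ := Submodule.mem_sup.1 (hV' z hz.2)
      have h1 := congrArg (pr P.gm n) hvq
      rw [map_add, hSV v hv n hnS, zero_add, pr_same _ hz.1] at h1
      rw [← h1]; exact hI hq
    unfold HHspace
    rw [Submodule.Quotient.subsingleton_iff, eq_top_iff]
    rintro ⟨z, hz⟩ _
    exact ⟨⟨hz.1, key z hz⟩, hz⟩


/-- If `A` is a compact and homologically smooth DG algebra over a
field `k`, then the total Hochschild homology `⊕ₙ HH_n(A)` is finite dimensional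
over `k`.  `HH_n(A)` is computed from any h-projective bimodule resolution
`F : P → A` of the diagonal bimodule. -/
theorem hochschild_finite_dimensional {k : Type} [Field k] (A : DGAlgebra k)
    (hc : IsCompactAlg A) (hs : IsSmooth A)
    (P : DGBimod A) (F : BimodHom P (diagBimod A)) (hPF : IsDiagResolution P F) :
    (∀ n : ℤ, FiniteDimensional k (HHspace P n)) ∧
      {n : ℤ | ¬ Subsingleton (HHspace P n)}.Finite := by
  obtain ⟨T, Q, hT, hQ, G, hG⟩ := hs
  exact small_final (small_retract
    (retract F hPF.1 hPF.2 (twisted_hoproj hT) hQ G hG) (twisted_small hc hT))
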